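/- arXiv:2501.04854 — 9 statements merged into one kernel-verified Lean document; each statement's English description precedes it below -/
import Mathlib

section
/- Symmetrization of the dual partial-Fourier LP (first direction of Lemma 4.1, over F_2): If (h_{k,M})_{k∈[ℓ], M∈GL_ℓ(F_2)} is feasible for the dual partial-Fourier LP (pLPdual), then the family (g_k)_{k∈[ℓ]} defined by g_k(X) := Σ_{M∈GL_ℓ(F_2)} F_{k,M}(h_{k,M})(M·X) is feasible for the symmetrized dual LP (symmpLPdual), and 1 + Σ_{k∈[ℓ]} g_k(0) = 1 + Σ_{k∈[ℓ]} Σ_{M∈GL_ℓ(F_2)} F_{k,M}(h_{k,M})(0), i.e., both solutions have the same value. -/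
open scoped BigOperators MatrixGroups

/-- `χ_y(x) = (−1)^{Σ_k x_k y_k}` over `F_2`. -/
def chi2 {n : ℕ} (y x : Fin n → ZMod 2) : ℝ :=
  (-1 : ℝ) ^ (∑ k, y k * x k : ZMod 2).val

/-- `χ_Y^{(k)}(X) = 2^{(ℓ−k)n} (∏_{j=1}^k χ_{Y_j}(X_j)) (∏_{j=k+1}^ℓ 1[Y_j = X_j])`. -/
def chiK2 {ℓ n : ℕ} (k : ℕ) (Y X : Matrix (Fin ℓ) (Fin n) (ZMod 2)) : ℝ :=
  (2 : ℝ) ^ ((ℓ - k) * n) *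
    ∏ j : Fin ℓ, if (j : ℕ) < k then chi2 (Y j) (X j)
      else if ∀ i, Y j i = X j i then 1 else 0

/-- Partial Fourier transform `F_k(f)(X) = 2^{−ℓn} Σ_Z f(Z) χ_X^{(k)}(Z)`. -/
noncomputable def pF2 {ℓ n : ℕ} (k : ℕ)
    (f : Matrix (Fin ℓ) (Fin n) (ZMod 2) → ℝ) (X : Matrix (Fin ℓ) (Fin n) (ZMod 2)) : ℝ :=
  ((2 : ℝ) ^ (ℓ * n))⁻¹ * ∑ Z, f Z * chiK2 k X Z

/-- `F_{k,M}(f)(X) = F_k(f·M)(M⁻¹·X)` where `(f·M)(Z) = f(M·Z)`. -/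
noncomputable def pFkM {ℓ n : ℕ} (k : ℕ) (M : GL (Fin ℓ) (ZMod 2))
    (f : Matrix (Fin ℓ) (Fin n) (ZMod 2) → ℝ) (X : Matrix (Fin ℓ) (Fin n) (ZMod 2)) : ℝ :=
  pF2 k (fun Z => f ((M : Matrix (Fin ℓ) (Fin ℓ) (ZMod 2)) * Z))
    (((M⁻¹ : GL (Fin ℓ) (ZMod 2)) : Matrix (Fin ℓ) (Fin ℓ) (ZMod 2)) * X)

/-- `Valid_{n,ℓ}` : matrices whose row span belongs to `V`. -/
def ValidM2 {n : ℕ} (V : Set (Submodule (ZMod 2) (Fin n → ZMod 2))) (ℓ : ℕ) :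
    Set (Matrix (Fin ℓ) (Fin n) (ZMod 2)) :=
  {X | Submodule.span (ZMod 2) (Set.range fun i => X i) ∈ V}

/-- Feasibility for the dual partial-Fourier LP (pLPdual). -/
noncomputable def FeasiblePLP {ℓ n : ℕ} (V : Set (Submodule (ZMod 2) (Fin n → ZMod 2)))
    (h : Fin ℓ → GL (Fin ℓ) (ZMod 2) → Matrix (Fin ℓ) (Fin n) (ZMod 2) → ℝ) : Prop :=
  (∀ (k : Fin ℓ) (M : GL (Fin ℓ) (ZMod 2)) (X), 0 ≤ h k M X) ∧
  ∀ X ∈ ValidM2 V ℓ, X ≠ 0 →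
    1 + ∑ k : Fin ℓ, ∑ M : GL (Fin ℓ) (ZMod 2), pFkM ((k : ℕ) + 1) M (h k M) X ≤ 0

/-- Feasibility for the symmetrized dual LP (symmpLPdual). -/
noncomputable def FeasibleSymm {ℓ n : ℕ} (V : Set (Submodule (ZMod 2) (Fin n → ZMod 2)))
    (g : Fin ℓ → Matrix (Fin ℓ) (Fin n) (ZMod 2) → ℝ) : Prop :=
  (∀ (k : Fin ℓ) (X), 0 ≤ pF2 ((k : ℕ) + 1) (g k) X) ∧
  ∀ X ∈ ValidM2 V ℓ, X ≠ 0 →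
    1 + ((Fintype.card (GL (Fin ℓ) (ZMod 2)) : ℝ))⁻¹ *
      ∑ k : Fin ℓ, ∑ M : GL (Fin ℓ) (ZMod 2),
        g k ((M : Matrix (Fin ℓ) (Fin ℓ) (ZMod 2)) * X) ≤ 0

/-- The character `chi2` is the product of the one-dimensional characters. -/
lemma chi2_eq_prod {n : ℕ} (y x : Fin n → ZMod 2) :
    chi2 y x = ∏ i, (-1 : ℝ) ^ (y i * x i).val := by
  have hadd (a b : ZMod 2) :
      (-1 : ℝ) ^ (a + b).val = (-1 : ℝ) ^ a.val * (-1 : ℝ) ^ b.val := by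
    rw [← pow_add, ZMod.val_add]
    exact (neg_one_pow_eq_pow_mod_two _).symm
  unfold chi2
  induction (Finset.univ : Finset (Fin n)) using Finset.cons_induction with
  | empty => simp
  | cons a s ha ih => rw [Finset.sum_cons, Finset.prod_cons, hadd, ih]

lemma sum_chi2_mul_chi2_nonneg {n : ℕ} (w x : Fin n → ZMod 2) :
    0 ≤ ∑ z, chi2 z w * chi2 x z := by
  simp_rw [chi2_eq_prod, ← Finset.prod_mul_distrib]
  rw [← Fintype.prod_sum fun i (a : ZMod 2) =>
    (-1 : ℝ) ^ (a * w i).val * (-1 : ℝ) ^ (x i * a).val]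
  refine Finset.prod_nonneg fun i _ => ?_
  have hsum (f : ZMod 2 → ℝ) : ∑ a, f a = f 0 + f 1 := Fin.sum_univ_two f
  rw [hsum]
  have hcases : ∀ a : ZMod 2, a = 0 ∨ a = 1 := by decide
  rcases hcases (w i) with hw | hw <;> rcases hcases (x i) with hx | hx <;>
    simp [hw, hx, ZMod.val_one]

/-- The composition of the partial Fourier kernel with itself is nonnegative. -/
lemma sum_chiK2_mul_chiK2_nonneg {ℓ n : ℕ} (k : ℕ)
    (W X : Matrix (Fin ℓ) (Fin n) (ZMod 2)) :
    0 ≤ ∑ Z, chiK2 k Z W * chiK2 k X Z := by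
  simp_rw [chiK2, mul_mul_mul_comm, ← Finset.mul_sum, ← Finset.prod_mul_distrib]
  refine mul_nonneg (by positivity) ?_
  have hfac := Fintype.prod_sum fun (j : Fin ℓ) (z : Fin n → ZMod 2) =>
    (if (j : ℕ) < k then chi2 z (W j) else if ∀ i, z i = W j i then 1 else 0) *
    (if (j : ℕ) < k then chi2 (X j) z else if ∀ i, X j i = z i then 1 else 0)
  refine le_of_le_of_eq (Finset.prod_nonneg fun j _ => ?_) hfac
  split_ifs with hj
  · exact sum_chi2_mul_chi2_nonneg _ _
  · exact Finset.sum_nonneg fun z _ => by split_ifs <;> simp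

lemma pF2_pF2_nonneg {ℓ n : ℕ} (k : ℕ) {f : Matrix (Fin ℓ) (Fin n) (ZMod 2) → ℝ}
    (hf : ∀ Z, 0 ≤ f Z) (X : Matrix (Fin ℓ) (Fin n) (ZMod 2)) :
    0 ≤ pF2 k (pF2 k f) X := by
  refine mul_nonneg (by positivity) ?_
  simp_rw [pF2, mul_assoc, ← Finset.mul_sum, Finset.sum_mul]
  rw [Finset.sum_comm]
  simp_rw [mul_assoc, ← Finset.mul_sum]
  exact mul_nonneg (by positivity) <| Finset.sum_nonneg fun W _ =>
    mul_nonneg (hf W) (sum_chiK2_mul_chiK2_nonneg k W X)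

lemma pF2_sum {ℓ n : ℕ} {ι : Type*} (s : Finset ι) (k : ℕ)
    (f : ι → Matrix (Fin ℓ) (Fin n) (ZMod 2) → ℝ) (X : Matrix (Fin ℓ) (Fin n) (ZMod 2)) :
    pF2 k (fun Z => ∑ i ∈ s, f i Z) X = ∑ i ∈ s, pF2 k (f i) X := by
  simp_rw [pF2, Finset.sum_mul]
  rw [Finset.sum_comm, Finset.mul_sum]

lemma pFkM_mul {ℓ n : ℕ} (k : ℕ) (M : GL (Fin ℓ) (ZMod 2))
    (f : Matrix (Fin ℓ) (Fin n) (ZMod 2) → ℝ) (X : Matrix (Fin ℓ) (Fin n) (ZMod 2)) :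
    pFkM k M f ((M : Matrix (Fin ℓ) (Fin ℓ) (ZMod 2)) * X) =
      pF2 k (fun Z => f ((M : Matrix (Fin ℓ) (Fin ℓ) (ZMod 2)) * Z)) X := by
  rw [pFkM, ← Matrix.mul_assoc, Units.inv_mul, Matrix.one_mul]

lemma span_rows_mul_le {R : Type*} [CommRing R] {l m n : Type*} [Fintype m]
    (A : Matrix l m R) (X : Matrix m n R) :
    Submodule.span R (Set.range fun i => (A * X) i) ≤
      Submodule.span R (Set.range fun i => X i) := by
  rw [Submodule.span_le]
  rintro _ ⟨i, rfl⟩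
  have hrow : (A * X) i = ∑ j, A i j • X j := by
    ext c
    simp [Matrix.mul_apply]
  simp only [hrow]
  exact Submodule.sum_mem _ fun j _ =>
    Submodule.smul_mem _ _ (Submodule.subset_span ⟨j, rfl⟩)

lemma GL_inv_mul_mul {ℓ n : ℕ} (M : GL (Fin ℓ) (ZMod 2))
    (X : Matrix (Fin ℓ) (Fin n) (ZMod 2)) :
    ((M⁻¹ : GL (Fin ℓ) (ZMod 2)) : Matrix (Fin ℓ) (Fin ℓ) (ZMod 2)) *
      ((M : Matrix (Fin ℓ) (Fin ℓ) (ZMod 2)) * X) = X := by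
  rw [← Matrix.mul_assoc, Units.inv_mul, Matrix.one_mul]

lemma GL_mul_mem_ValidM2 {ℓ n : ℕ} {V : Set (Submodule (ZMod 2) (Fin n → ZMod 2))}
    (M : GL (Fin ℓ) (ZMod 2)) {X : Matrix (Fin ℓ) (Fin n) (ZMod 2)} (hX : X ∈ ValidM2 V ℓ) :
    (M : Matrix (Fin ℓ) (Fin ℓ) (ZMod 2)) * X ∈ ValidM2 V ℓ := by
  have hle := span_rows_mul_le
    ((M⁻¹ : GL (Fin ℓ) (ZMod 2)) : Matrix (Fin ℓ) (Fin ℓ) (ZMod 2))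
    ((M : Matrix (Fin ℓ) (Fin ℓ) (ZMod 2)) * X)
  rw [GL_inv_mul_mul] at hle
  unfold ValidM2 at hX ⊢
  rwa [Set.mem_ofPred_eq, le_antisymm (span_rows_mul_le _ X) hle]

lemma GL_mul_ne_zero {ℓ n : ℕ} (M : GL (Fin ℓ) (ZMod 2))
    {X : Matrix (Fin ℓ) (Fin n) (ZMod 2)} (hX : X ≠ 0) :
    (M : Matrix (Fin ℓ) (Fin ℓ) (ZMod 2)) * X ≠ 0 := fun h0 => hX <| by
  rw [← GL_inv_mul_mul M X, h0, Matrix.mul_zero]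

/-- **Symmetrization of the dual partial-Fourier LP** (first direction of Lemma 4.1 over `F_2`). -/
theorem symmetrize_dual
    (ℓ n : ℕ) (hℓ : 0 < ℓ) (hn : 0 < n)
    (V : Set (Submodule (ZMod 2) (Fin n → ZMod 2)))
    (h : Fin ℓ → GL (Fin ℓ) (ZMod 2) → Matrix (Fin ℓ) (Fin n) (ZMod 2) → ℝ)
    (hfeas : FeasiblePLP V h)
    (g : Fin ℓ → Matrix (Fin ℓ) (Fin n) (ZMod 2) → ℝ)
    (hg : ∀ (k : Fin ℓ) (X),
      g k X = ∑ M : GL (Fin ℓ) (ZMod 2),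
        pFkM ((k : ℕ) + 1) M (h k M) ((M : Matrix (Fin ℓ) (Fin ℓ) (ZMod 2)) * X)) :
    FeasibleSymm V g ∧
      1 + ∑ k : Fin ℓ, g k 0 =
        1 + ∑ k : Fin ℓ, ∑ M : GL (Fin ℓ) (ZMod 2), pFkM ((k : ℕ) + 1) M (h k M) 0 := by
  refine ⟨⟨fun k X => ?_, fun X hX hX0 => ?_⟩, by simp [hg]⟩
  · have hgk : g k = pF2 ((k : ℕ) + 1) fun Z => ∑ M : GL (Fin ℓ) (ZMod 2),
        h k M ((M : Matrix (Fin ℓ) (Fin ℓ) (ZMod 2)) * Z) := by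
      ext Y
      simp_rw [hg, pFkM_mul, pF2_sum]
    rw [hgk]
    exact pF2_pF2_nonneg _ (fun Z => Finset.sum_nonneg fun M _ => hfeas.1 k M _) X
  · have hswap : ∑ k : Fin ℓ, ∑ N : GL (Fin ℓ) (ZMod 2),
          g k ((N : Matrix (Fin ℓ) (Fin ℓ) (ZMod 2)) * X) =
        ∑ N : GL (Fin ℓ) (ZMod 2), ∑ k : Fin ℓ, ∑ M : GL (Fin ℓ) (ZMod 2),
          pFkM ((k : ℕ) + 1) M (h k M) ((N : Matrix (Fin ℓ) (Fin ℓ) (ZMod 2)) * X) := by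
      rw [Finset.sum_comm (s := (Finset.univ : Finset (GL (Fin ℓ) (ZMod 2))))]
      refine Finset.sum_congr rfl fun k _ => ?_
      simp_rw [hg]
      rw [Finset.sum_comm]
      conv_rhs => rw [Finset.sum_comm]
      refine Finset.sum_congr rfl fun M _ => ?_
      refine Fintype.sum_equiv (Equiv.mulLeft M) _ _ fun N => ?_
      rw [Equiv.coe_mulLeft, Units.val_mul, Matrix.mul_assoc]
    have hbound : ∑ N : GL (Fin ℓ) (ZMod 2), ∑ k : Fin ℓ, ∑ M : GL (Fin ℓ) (ZMod 2),
          pFkM ((k : ℕ) + 1) M (h k M) ((N : Matrix (Fin ℓ) (Fin ℓ) (ZMod 2)) * X) ≤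
        ∑ _N : GL (Fin ℓ) (ZMod 2), (-1 : ℝ) :=
      Finset.sum_le_sum fun N _ => by
        linarith [hfeas.2 _ (GL_mul_mem_ValidM2 N hX) (GL_mul_ne_zero N hX0)]
    rw [Finset.sum_const, Finset.card_univ, nsmul_eq_mul] at hbound
    have hcard : (0 : ℝ) < Fintype.card (GL (Fin ℓ) (ZMod 2)) := by
      exact_mod_cast Fintype.card_pos
    rw [hswap]
    calc _ ≤ 1 + ((Fintype.card (GL (Fin ℓ) (ZMod 2)) : ℝ))⁻¹ *
          ((Fintype.card (GL (Fin ℓ) (ZMod 2)) : ℝ) * -1) := by gcongr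
      _ = 0 := by field_simp; ring
end

section
/- Size of the annihilator set M_q^{s,t}(X) (Lemma 4.5(iii)): Let q be a prime power, let s, t, ℓ, n ∈ ℕ with s ≤ t ≤ ℓ ≤ n, and let X ∈ F_q^{ℓ×n}. With z = s + ℓ − t and r = rank(X), one has |M_q^{s,t}(X)| = (q−1)^ℓ · q^{ℓ(ℓ−1)/2} · (ℓ−z)_{r,q} · (ℓ−r)!_q. In particular |M_q^{s,t}(X)| = |M_q^{z,ℓ}(X)|. -/
open scoped BigOperators MatrixGroups

/-- `[m]_q`: the geometric sum `1 + q + ⋯ + q^{m−1}` for `m ≥ 1`, and `0` for `m ≤ 0`. -/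
def qInt (q : ℕ) (m : ℤ) : ℕ := ∑ j ∈ Finset.range m.toNat, q ^ j

/-- The q-falling factorial `(a)_{r,q} = ∏_{j=0}^{r−1} [a−j]_q`. -/
def qFall (q : ℕ) (a : ℤ) (r : ℕ) : ℕ := ∏ j ∈ Finset.range r, qInt q (a - j)

/-- The q-factorial `r!_q = (r)_{r,q}`. -/
def qFact (q : ℕ) (r : ℕ) : ℕ := qFall q r r

/-- `M_q^{s,t}(X) = {M ∈ GL_ℓ(F_q) : (M·X)_{1,…,s} = 0 and (M·X)_{t+1,…,ℓ} = 0}`. -/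
def Mqst {F : Type} [Field F] [Fintype F] [DecidableEq F] {ℓ n : ℕ} (s t : ℕ)
    (X : Matrix (Fin ℓ) (Fin n) F) : Finset (GL (Fin ℓ) F) :=
  Finset.univ.filter fun M =>
    ∀ i : Fin ℓ, ((i : ℕ) < s ∨ t ≤ (i : ℕ)) →
      ∀ j, ((M : Matrix (Fin ℓ) (Fin ℓ) F) * X) i j = 0

/-- The number of linearly independent families whose `i`-th vector is confined to `U i`, for an
increasing sequence of subspaces `U`. -/
theorem card_linearIndependent_mem_monotone {F V : Type*} [Field F] [Fintype F] [AddCommGroup V]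
    [Module F V] [Finite V] (U : ℕ → Submodule F V) (hU : Monotone U) (k : ℕ) :
    Nat.card {v : Fin k → V // LinearIndependent F v ∧ ∀ i : Fin k, v i ∈ U i} =
      ∏ i ∈ Finset.range k,
        (Fintype.card F ^ Module.finrank F (U i) - Fintype.card F ^ i) := by
  classical
  induction k with
  | zero =>
    have : Unique {v : Fin 0 → V // LinearIndependent F v ∧ ∀ i : Fin 0, v i ∈ U i} :=
      { default := ⟨Fin.elim0, linearIndependent_empty_type, fun i => i.elim0⟩
        uniq := fun _ => Subtype.ext (Subsingleton.elim _ _) }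
    simp
  | succ k ih =>
    let e : {v : Fin (k + 1) → V // LinearIndependent F v ∧ ∀ i : Fin (k + 1), v i ∈ U i} ≃
        Σ v : {v : Fin k → V // LinearIndependent F v ∧ ∀ i : Fin k, v i ∈ U i},
          ((U k : Set V) \ (Submodule.span F (Set.range v.1) : Set V) : Set V) :=
      { toFun := fun v => ⟨⟨Fin.init v.1, by
            have h := v.2.1
            rw [← Fin.snoc_init_self v.1, linearIndependent_finSnoc] at h
            exact h.1, fun i => v.2.2 i.castSucc⟩,
          v.1 (Fin.last k), by simpa using v.2.2 (Fin.last k), by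
            have h := v.2.1
            rw [← Fin.snoc_init_self v.1, linearIndependent_finSnoc] at h
            exact h.2⟩
        invFun := fun p => ⟨Fin.snoc p.1.1 p.2.1,
          linearIndependent_finSnoc.2 ⟨p.1.2.1, p.2.2.2⟩, fun i => by
            refine Fin.lastCases ?_ (fun i => ?_) i
            · simpa using p.2.2.1
            · simpa using p.1.2.2 i⟩
        left_inv := fun v => Subtype.ext (Fin.snoc_init_self v.1)
        right_inv := fun p => Sigma.subtype_ext
          (Subtype.ext (Fin.init_snoc (α := fun _ => V) p.2.1 p.1.1))
          (Fin.snoc_last (α := fun _ => V) p.2.1 p.1.1) }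
    have hfib (v : {v : Fin k → V // LinearIndependent F v ∧ ∀ i : Fin k, v i ∈ U i}) :
        Nat.card ((U k : Set V) \ (Submodule.span F (Set.range v.1) : Set V) : Set V) =
          Fintype.card F ^ Module.finrank F (U k) - Fintype.card F ^ k := by
      have hle : Submodule.span F (Set.range v.1) ≤ U k := by
        rw [Submodule.span_le]
        rintro _ ⟨i, rfl⟩
        exact hU i.2.le (v.2.2 i)
      rw [Nat.card_coe_set_eq, Set.ncard_sdiff hle (Set.toFinite _), ← Nat.card_coe_set_eq,
        ← Nat.card_coe_set_eq]
      change Nat.card (U k) - Nat.card (Submodule.span F (Set.range v.1)) = _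
      rw [Module.natCard_eq_pow_finrank (K := F) (V := U k),
        Module.natCard_eq_pow_finrank (K := F) (V := Submodule.span F (Set.range v.1)),
        finrank_span_eq_card v.2.1, Fintype.card_fin, Nat.card_eq_fintype_card]
    have : Fintype {v : Fin k → V // LinearIndependent F v ∧ ∀ i : Fin k, v i ∈ U i} :=
      Fintype.ofFinite _
    rw [Nat.card_congr e, Nat.card_sigma, Finset.sum_congr rfl fun v _ => hfib v,
      Finset.prod_range_succ, ← ih]
    simp

theorem pow_sub_pow_eq_mul_qInt {q : ℕ} (hq : 1 ≤ q) (a i : ℕ) :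
    q ^ a - q ^ i = q ^ i * (q - 1) * qInt q ((a : ℤ) - i) := by
  rcases le_total a i with h | h
  · have h0 : ((a : ℤ) - i).toNat = 0 := by omega
    simp [qInt, h0, Nat.sub_eq_zero_of_le (Nat.pow_le_pow_right hq h)]
  · obtain ⟨d, rfl⟩ := Nat.exists_eq_add_of_le h
    have hd : (((i + d : ℕ) : ℤ) - i).toNat = d := by omega
    have hg : (q - 1) * ∑ j ∈ Finset.range d, q ^ j = q ^ d - 1 := by
      obtain ⟨m, rfl⟩ := Nat.exists_eq_add_of_le' hq
      have := geom_sum_mul_add m d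
      simp only [Nat.add_sub_cancel]
      rw [← this, mul_comm]; simp
    rw [qInt, hd, mul_assoc, hg, Nat.mul_sub, pow_add, mul_one]

theorem qFall_add (q : ℕ) (a : ℤ) (m k : ℕ) :
    qFall q a (m + k) = qFall q a m * qFall q (a - m) k := by
  simp only [qFall, Finset.prod_range_add]
  congr 1
  refine Finset.prod_congr rfl fun j _ => ?_
  congr 1
  push_cast
  ring

theorem qFall_eq_zero (q : ℕ) {a r : ℕ} (h : a < r) : qFall q a r = 0 :=
  Finset.prod_eq_zero (Finset.mem_range.2 h) (by simp [qInt])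

theorem qFall_mul_qFact_comm (q : ℕ) {ℓ z r : ℕ} (hz : z ≤ ℓ) (hr : r ≤ ℓ) :
    qFall q (ℓ - r : ℕ) z * qFact q (ℓ - z) = qFall q (ℓ - z : ℕ) r * qFact q (ℓ - r) := by
  rcases le_or_gt (z + r) ℓ with h | h
  · obtain ⟨d, rfl⟩ := Nat.exists_eq_add_of_le h
    have h1 : z + r + d - r = z + d := by omega
    have h2 : z + r + d - z = r + d := by omega
    rw [h1, h2, qFact, qFact, qFall_add q _ r d, qFall_add q _ z d]
    have h3 : ((r + d : ℕ) : ℤ) - r = d := by push_cast; ring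
    have h4 : ((z + d : ℕ) : ℤ) - z = d := by push_cast; ring
    rw [h3, h4]
    ring
  · rw [qFall_eq_zero q (show ℓ - r < z by omega), qFall_eq_zero q (show ℓ - z < r by omega)]
    simp

theorem prod_pow_sub_pow_eq {q : ℕ} (hq : 1 ≤ q) {ℓ z r : ℕ} (hz : z ≤ ℓ) (hr : r ≤ ℓ) :
    ∏ i ∈ Finset.range ℓ, (q ^ (if i < z then ℓ - r else ℓ) - q ^ i) =
      (q - 1) ^ ℓ * q ^ (ℓ * (ℓ - 1) / 2) * qFall q (ℓ - z : ℕ) r * qFact q (ℓ - r) := by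
  have key : ∏ i ∈ Finset.range ℓ, qInt q (((if i < z then ℓ - r else ℓ : ℕ) : ℤ) - i) =
      qFall q (ℓ - r : ℕ) z * qFact q (ℓ - z) := by
    obtain ⟨d, rfl⟩ := Nat.exists_eq_add_of_le hz
    rw [Finset.prod_range_add, Nat.add_sub_cancel_left, qFact, qFall, qFall]
    congr 1
    · exact Finset.prod_congr rfl fun i hi => by rw [if_pos (Finset.mem_range.1 hi)]
    · refine Finset.prod_congr rfl fun i _ => ?_
      rw [if_neg (by omega)]
      congr 1
      push_cast
      ring
  simp only [pow_sub_pow_eq_mul_qInt hq, Finset.prod_mul_distrib]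
  rw [key, qFall_mul_qFact_comm q hz hr, Finset.prod_pow_eq_pow_sum, Finset.sum_range_id,
    Finset.prod_const, Finset.card_range]
  ring

/-- Invertible matrices correspond to linearly independent families through their rows. -/
noncomputable def glEquivRows (F : Type*) [Field F] (ℓ : ℕ) :
    GL (Fin ℓ) F ≃ {v : Fin ℓ → Fin ℓ → F // LinearIndependent F v} where
  toFun M := ⟨M.1.row, Matrix.linearIndependent_rows_iff_isUnit.2 M.isUnit⟩
  invFun v := (Matrix.linearIndependent_rows_iff_isUnit (A := Matrix.of v.1).1 v.2).unit
  left_inv _ := Units.ext rfl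
  right_inv _ := rfl

/-- The cyclic shift by `ℓ - t`, moving the indices `i < s` and `t ≤ i` to the first
`s + ℓ - t` positions. -/
def shiftPerm {t ℓ : ℕ} (htl : t ≤ ℓ) : Equiv.Perm (Fin ℓ) where
  toFun i := ⟨if (i : ℕ) < t then i + (ℓ - t) else i - t, by have := i.2; split_ifs <;> omega⟩
  invFun i := ⟨if (i : ℕ) < ℓ - t then i + t else i - (ℓ - t), by
    have := i.2; split_ifs <;> omega⟩
  left_inv i := by ext; have := i.2; dsimp only; split_ifs <;> omega
  right_inv i := by ext; have := i.2; dsimp only; split_ifs <;> omega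

theorem shiftPerm_lt_iff {s t ℓ : ℕ} (htl : t ≤ ℓ) (i : Fin ℓ) :
    (shiftPerm htl i : ℕ) < s + ℓ - t ↔ (i : ℕ) < s ∨ t ≤ (i : ℕ) := by
  have := i.2
  simp only [shiftPerm, Equiv.coe_fn_mk]
  split_ifs <;> omega

theorem card_Mqst_eq_prod {F : Type} [Field F] [Fintype F] [DecidableEq F] {s t ℓ n : ℕ}
    (htl : t ≤ ℓ) (X : Matrix (Fin ℓ) (Fin n) F) :
    (Mqst s t X).card =
      ∏ i ∈ Finset.range ℓ, (Fintype.card F ^ (if i < s + ℓ - t then ℓ - X.rank else ℓ) -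
        Fintype.card F ^ i) := by
  classical
  set W : Submodule F (Fin ℓ → F) := LinearMap.ker X.transpose.mulVecLin with hW
  let U : ℕ → Submodule F (Fin ℓ → F) := fun i => if i < s + ℓ - t then W else ⊤
  have hU : Monotone U := by
    intro i j hij
    by_cases hj : j < s + ℓ - t
    · simp [U, hj, hij.trans_lt hj]
    · simp [U, hj]
  have hmem (v : Fin ℓ → F) : v ∈ W ↔ ∀ j, Matrix.vecMul v X j = 0 := by
    simp [hW, LinearMap.mem_ker, funext_iff]
  have hWrank : Module.finrank F W = ℓ - X.rank := by
    have h := X.transpose.mulVecLin.finrank_range_add_finrank_ker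
    change X.transpose.rank + _ = _ at h
    rw [Matrix.rank_transpose, Module.finrank_fin_fun] at h
    exact (Nat.sub_eq_of_eq_add' h.symm).symm
  have hUrank (i : ℕ) :
      Module.finrank F (U i) = if i < s + ℓ - t then ℓ - X.rank else ℓ := by
    split_ifs with hi
    · rw [show U i = W from if_pos hi, hWrank]
    · rw [show U i = ⊤ from if_neg hi, finrank_top, Module.finrank_fin_fun]
  have e : {M : GL (Fin ℓ) F // M ∈ Mqst s t X} ≃
      {v : Fin ℓ → Fin ℓ → F // LinearIndependent F v ∧ ∀ i : Fin ℓ, v i ∈ U i} :=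
    ((glEquivRows F ℓ).subtypeEquiv (q := fun v => ∀ i : Fin ℓ, v.1 i ∈ U (shiftPerm htl i))
      fun M => by
        simp only [Mqst, Finset.mem_filter, Finset.mem_univ, true_and]
        refine forall_congr' fun i => ?_
        rw [← shiftPerm_lt_iff htl i]
        by_cases hi : (shiftPerm htl i : ℕ) < s + ℓ - t
        · simp only [hi, true_imp_iff, U, if_true, hmem]
          rfl
        · simp [hi, U]).trans <|
    (Equiv.subtypeSubtypeEquivSubtypeInter _
      fun v : Fin ℓ → Fin ℓ → F => ∀ i : Fin ℓ, v i ∈ U (shiftPerm htl i)).trans <|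
    ((shiftPerm htl).arrowCongr (Equiv.refl _)).subtypeEquiv fun v => by
      refine and_congr (linearIndependent_equiv (shiftPerm htl).symm).symm ?_
      rw [← (shiftPerm htl).forall_congr_right
        (q := fun i : Fin ℓ => (shiftPerm htl).arrowCongr (Equiv.refl _) v i ∈ U i)]
      simp
  rw [← Fintype.card_coe, ← Nat.card_eq_fintype_card, Nat.card_congr e,
    card_linearIndependent_mem_monotone U hU]
  simp only [hUrank]

/-- **Size of the annihilator set `M_q^{s,t}(X)`** (Lemma 4.5(iii)):
`|M_q^{s,t}(X)| = (q−1)^ℓ q^{ℓ(ℓ−1)/2} (ℓ−z)_{r,q} (ℓ−r)!_q` with `z = s+ℓ−t`, `r = rank X`;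
in particular `|M_q^{s,t}(X)| = |M_q^{z,ℓ}(X)|`. -/
theorem card_Mqst {F : Type} [Field F] [Fintype F] [DecidableEq F]
    (s t ℓ n : ℕ) (hst : s ≤ t) (htl : t ≤ ℓ) (hln : ℓ ≤ n)
    (X : Matrix (Fin ℓ) (Fin n) F) :
    (Mqst s t X).card =
      (Fintype.card F - 1) ^ ℓ * Fintype.card F ^ (ℓ * (ℓ - 1) / 2) *
        qFall (Fintype.card F) ((ℓ : ℤ) - ((s + ℓ - t : ℕ) : ℤ)) X.rank *
        qFact (Fintype.card F) (ℓ - X.rank) ∧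
    (Mqst s t X).card = (Mqst (s + ℓ - t) ℓ X).card := by
  have hcard (s t : ℕ) (hst : s ≤ t) (htl : t ≤ ℓ) : (Mqst s t X).card =
      (Fintype.card F - 1) ^ ℓ * Fintype.card F ^ (ℓ * (ℓ - 1) / 2) *
        qFall (Fintype.card F) ((ℓ : ℤ) - ((s + ℓ - t : ℕ) : ℤ)) X.rank *
        qFact (Fintype.card F) (ℓ - X.rank) := by
    have hz : s + ℓ - t ≤ ℓ := by omega
    rw [card_Mqst_eq_prod htl, prod_pow_sub_pow_eq Fintype.card_pos hz (X.rank_le_height),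
      Nat.cast_sub hz]
  refine ⟨hcard s t hst htl, ?_⟩
  rw [hcard s t hst htl, hcard (s + ℓ - t) ℓ (by omega) le_rfl, Nat.add_sub_cancel]
end

section
/- GL_s-invariance of the distribution of the top rows (Lemma 4.5(ii), counting form): Let q be a prime power, let s, t, ℓ, n ∈ ℕ with s ≤ t ≤ ℓ ≤ n, and let X ∈ F_q^{ℓ×n}. Then for every N ∈ GL_s(F_q) and every W ∈ F_q^{s×n}, the number of M ∈ M_q^{0,t}(X) with (M·X)_{1,…,s} = W equals the number of M ∈ M_q^{0,t}(X) with (M·X)_{1,…,s} = N·W. Equivalently, if M is chosen uniformly at random from M_q^{0,t}(X), the distribution of (M·X)_{1,…,s} is invariant under left multiplication by GL_s(F_q). -/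
open scoped BigOperators MatrixGroups

/-- The submatrix consisting of the first `s` rows. -/
def topRows {F : Type} {ℓ n : ℕ} (s : ℕ) (hs : s ≤ ℓ) (Y : Matrix (Fin ℓ) (Fin n) F) :
    Matrix (Fin s) (Fin n) F :=
  fun i j => Y ⟨(i : ℕ), lt_of_lt_of_le i.isLt hs⟩ j

/-- The embedding `N ↦ diag(N, 1)` of `GL_s` into `GL_{s+k}`. -/
def glExtendOne {F : Type} [Field F] {s : ℕ} (k : ℕ) (N : GL (Fin s) F) :
    GL (Fin (s + k)) F where
  val := (Matrix.fromBlocks (N : Matrix (Fin s) (Fin s) F) 0 0 1).submatrix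
    finSumFinEquiv.symm finSumFinEquiv.symm
  inv := (Matrix.fromBlocks ((N⁻¹ : GL (Fin s) F) : Matrix (Fin s) (Fin s) F) 0 0 1).submatrix
    finSumFinEquiv.symm finSumFinEquiv.symm
  val_inv := by
    rw [Matrix.submatrix_mul_equiv, Matrix.fromBlocks_multiply]
    simp only [Units.mul_inv, Matrix.mul_zero, Matrix.zero_mul, add_zero, zero_add,
      Matrix.mul_one, Matrix.fromBlocks_one, Matrix.submatrix_one_equiv]
  inv_val := by
    rw [Matrix.submatrix_mul_equiv, Matrix.fromBlocks_multiply]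
    simp only [Units.inv_mul, Matrix.mul_zero, Matrix.zero_mul, add_zero, zero_add,
      Matrix.mul_one, Matrix.fromBlocks_one, Matrix.submatrix_one_equiv]

theorem topRows_glExtendOne_mul {F : Type} [Field F] {s k n : ℕ} (hs : s ≤ s + k)
    (N : GL (Fin s) F) (Y : Matrix (Fin (s + k)) (Fin n) F) :
    topRows s hs ((glExtendOne k N : Matrix (Fin (s + k)) (Fin (s + k)) F) * Y) =
      (N : Matrix (Fin s) (Fin s) F) * topRows s hs Y := by
  ext i j
  change ((glExtendOne k N : Matrix (Fin (s + k)) (Fin (s + k)) F) * Y) (Fin.castAdd k i) j = _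
  rw [Matrix.mul_apply, Matrix.mul_apply, Fin.sum_univ_add]
  simp [glExtendOne]
  rfl

theorem glExtendOne_mul_apply_of_le {F : Type} [Field F] {s k n : ℕ}
    (N : GL (Fin s) F) (Y : Matrix (Fin (s + k)) (Fin n) F) (i : Fin (s + k))
    (hi : s ≤ (i : ℕ)) (j : Fin n) :
    ((glExtendOne k N : Matrix (Fin (s + k)) (Fin (s + k)) F) * Y) i j = Y i j := by
  obtain ⟨i, rfl⟩ : ∃ i' : Fin k, i = Fin.natAdd s i' :=
    ⟨⟨i - s, by omega⟩, by ext; simp; omega⟩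
  rw [Matrix.mul_apply, Fin.sum_univ_add]
  simp [glExtendOne, Matrix.one_apply]

/-- **GL_s-invariance of the distribution of the top rows** (Lemma 4.5(ii), counting form):
for every `N ∈ GL_s(F_q)` and `W`, the number of `M ∈ M_q^{0,t}(X)` with `(M·X)_{1,…,s} = W`
equals the number with `(M·X)_{1,…,s} = N·W`. -/
theorem count_topRows_GL_invariant {F : Type} [Field F] [Fintype F] [DecidableEq F]
    (s t ℓ n : ℕ) (hst : s ≤ t) (htl : t ≤ ℓ) (hln : ℓ ≤ n)
    (X : Matrix (Fin ℓ) (Fin n) F)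
    (N : GL (Fin s) F) (W : Matrix (Fin s) (Fin n) F) :
    ((Mqst 0 t X).filter fun (M : GL (Fin ℓ) F) =>
        topRows s (hst.trans htl) ((M : Matrix (Fin ℓ) (Fin ℓ) F) * X) = W).card =
    ((Mqst 0 t X).filter fun (M : GL (Fin ℓ) F) =>
        topRows s (hst.trans htl) ((M : Matrix (Fin ℓ) (Fin ℓ) F) * X) =
          (N : Matrix (Fin s) (Fin s) F) * W).card := by
  obtain ⟨k, rfl⟩ := Nat.exists_eq_add_of_le (hst.trans htl)
  refine Finset.card_equiv (Equiv.mulLeft (glExtendOne k N)) fun M => ?_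
  have hN : Function.Injective
      fun V : Matrix (Fin s) (Fin n) F => (N : Matrix (Fin s) (Fin s) F) * V := by
    intro V V' h
    have h' := congrArg
      (fun U => ((N⁻¹ : GL (Fin s) F) : Matrix (Fin s) (Fin s) F) * U) h
    simpa only [← Matrix.mul_assoc, Units.inv_mul, Matrix.one_mul] using h'
  simp only [Finset.mem_filter, Mqst, Finset.mem_univ, true_and, Equiv.coe_mulLeft,
    Units.val_mul, Matrix.mul_assoc, topRows_glExtendOne_mul, hN.eq_iff, Nat.not_lt_zero,
    false_or]
  refine and_congr (forall_congr' fun i => forall_congr' fun hi => forall_congr' fun j => ?_) ?_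
  · rw [glExtendOne_mul_apply_of_le N _ i (hst.trans hi)]
  · exact Iff.rfl
end

section
/- Exact completeness of the hierarchy from the dual (Theorem 5.1): Let q be a prime power, n, ℓ ∈ ℕ₊ with ℓ ≥ n, and let Valid_n be a nonempty collection of F_q-linear subspaces of F_q^n closed under taking subspaces. Set k = max{dim_{F_q}(S) : S ∈ Valid_n}. Then the optimum of the level-ℓ subspace-symmetrized dual LP equals q^{ℓk}; that is, there exists a feasible triple (α, β, γ) with α = q^{ℓk}, and every feasible triple satisfies α ≥ q^{ℓk}. -/
open scoped BigOperators

/-- Feasibility for the level-`ℓ` subspace-symmetrized dual LP: `β, γ ≥ 0` and for every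
`S ∈ V`, `α = |S|^ℓ + |S|^ℓ Σ_{T ⊇ S} β(T) + Σ_{T ⊆ S} γ(T)`. -/
def Feasible6 {F : Type} [Field F] [Fintype F] {n : ℕ} (ℓ : ℕ)
    (V : Set (Submodule F (Fin n → F)))
    (α : ℝ) (β γ : Submodule F (Fin n → F) → ℝ) : Prop :=
  (∀ T, 0 ≤ β T) ∧ (∀ T, 0 ≤ γ T) ∧
  ∀ S ∈ V,
    α = (Nat.card ↥S : ℝ) ^ ℓ +
      (Nat.card ↥S : ℝ) ^ ℓ * (∑ᶠ (T : Submodule F (Fin n → F)) (_ : S ≤ T), β T) +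
      ∑ᶠ (T : Submodule F (Fin n → F)) (_ : T ≤ S), γ T

/-- On a finite partial order every real function is an upper-set sum of some `β`. -/
lemma exists_sum_ge_eq {P : Type*} [Fintype P] [PartialOrder P] (h : P → ℝ) :
    ∃ β : P → ℝ, ∀ a, ∑ᶠ (b : P) (_ : a ≤ b), β b = h a := by
  classical
  let step : (a : P) → ((b : P) → b > a → ℝ) → ℝ := fun a r =>
    h a - ∑ b, if hb : b > a then r b hb else 0
  refine ⟨(wellFounded_gt (α := P)).fix step, fun a => ?_⟩
  rw [finsum_eq_sum_of_fintype]
  simp only [finsum_eq_if]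
  have hfix := (wellFounded_gt (α := P)).fix_eq step a
  have hsplit : ∀ b : P, (if a ≤ b then (wellFounded_gt (α := P)).fix step b else 0) =
      (if b = a then (wellFounded_gt (α := P)).fix step a else 0) +
        if b > a then (wellFounded_gt (α := P)).fix step b else 0 := by
    intro b
    rcases eq_or_ne b a with rfl | hb
    · simp
    · simp [hb, gt_iff_lt, lt_iff_le_and_ne, hb.symm]
  rw [Finset.sum_congr rfl fun b _ => hsplit b, Finset.sum_add_distrib, Finset.sum_ite_eq',
    if_pos (Finset.mem_univ _), hfix]
  simp [step]

/-- If the upper-set sums of `β` over subspaces are `c ^ (k - dim S) - 1` with `c` at least the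
number of vectors, then `β` is nonnegative. -/
lemma nonneg_of_sum_ge_eq {F M : Type*} [Field F] [AddCommGroup M] [Module F M] [Fintype M]
    {c : ℝ} (k : ℕ) (hc : (Fintype.card M : ℝ) ≤ c) (β : Submodule F M → ℝ)
    (hβ : ∀ S, ∑ᶠ (T : Submodule F M) (_ : S ≤ T), β T = c ^ (k - Module.finrank F S) - 1)
    (S : Submodule F M) : 0 ≤ β S := by
  classical
  have := Fintype.ofFinite (Submodule F M)
  have hc1 : 1 ≤ c := le_trans (by exact_mod_cast Fintype.card_pos) hc
  simp only [finsum_eq_sum_of_fintype, finsum_eq_if] at hβ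
  induction S using (wellFounded_gt (α := Submodule F M)).induction with
  | _ S ih =>
  set m := k - Module.finrank F S - 1 with hm
  have hcm : 1 ≤ c ^ m := one_le_pow₀ hc1
  have hcover : ∀ T : Submodule F M, (if S ≤ T then β T else 0) ≤
      (if T = S then β S else 0) +
        ∑ v : M, if v ∉ S then (if S ⊔ F ∙ v ≤ T then β T else 0) else 0 := by
    intro T
    rcases eq_or_ne T S with rfl | hT
    · have : ∀ v : M, (if v ∉ T then (if T ⊔ F ∙ v ≤ T then β T else 0) else 0) = 0 := by
        intro v
        by_cases hv : v ∈ T <;> simp [hv]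
      rw [Finset.sum_congr rfl fun v _ => this v]
      simp
    by_cases hST : S ≤ T
    · have hlt : S < T := lt_of_le_of_ne hST hT.symm
      obtain ⟨v, hvT, hvS⟩ := SetLike.exists_of_lt hlt
      have hT0 := ih T hlt
      have hle := Finset.single_le_sum
        (f := fun v : M => if v ∉ S then (if S ⊔ F ∙ v ≤ T then β T else 0) else 0)
        (fun v _ => by split_ifs <;> first | exact hT0 | exact le_rfl)
        (Finset.mem_univ v)
      have hvle : S ⊔ F ∙ v ≤ T := sup_le hST ((Submodule.span_singleton_le_iff_mem v T).2 hvT)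
      simp only [hvS, not_false_eq_true, if_true, hvle] at hle
      simpa [hT, hST] using hle
    · have : ∀ v : M, ¬ S ⊔ F ∙ v ≤ T := fun v hv => hST (le_sup_left.trans hv)
      simp only [this]
      simp [hT, hST]
  have hsum := Finset.sum_le_sum fun T (_ : T ∈ Finset.univ) => hcover T
  rw [hβ, Finset.sum_add_distrib, Finset.sum_ite_eq', if_pos (Finset.mem_univ _),
    Finset.sum_comm] at hsum
  have hbound : ∑ v : M, ∑ T : Submodule F M,
      (if v ∉ S then (if S ⊔ F ∙ v ≤ T then β T else 0) else 0) ≤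
        Fintype.card M * (c ^ m - 1) := by
    have : ∀ v ∈ (Finset.univ : Finset M), ∑ T : Submodule F M,
        (if v ∉ S then (if S ⊔ F ∙ v ≤ T then β T else 0) else 0) ≤ c ^ m - 1 := by
      intro v _
      by_cases hv : v ∈ S
      · simpa [hv] using hcm
      · simp only [hv, not_false_eq_true, if_true]
        rw [hβ]
        have hlt : S < S ⊔ F ∙ v := by
          refine lt_of_le_of_ne le_sup_left fun he => hv ?_
          rw [he]
          exact Submodule.mem_sup_right (Submodule.mem_span_singleton_self v)
        have := Submodule.finrank_lt_finrank_of_lt hlt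
        gcongr
        omega
    simpa only [Finset.sum_const, Finset.card_univ, nsmul_eq_mul] using Finset.sum_le_sum this
  have hgrow : (Fintype.card M : ℝ) * (c ^ m - 1) ≤ c ^ (k - Module.finrank F S) - 1 := by
    rcases Nat.eq_zero_or_pos (k - Module.finrank F S) with h0 | h0
    · simp [hm, h0]
    · have : k - Module.finrank F S = m + 1 := by omega
      rw [this, pow_succ]
      nlinarith
  linarith

/-- **Exact completeness of the hierarchy from the dual** (Theorem 5.1): at levels `ℓ ≥ n`,
the optimum of the level-`ℓ` subspace-symmetrized dual LP equals `q^{ℓk}` where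
`k = max{dim S : S ∈ Valid_n}`. -/
theorem completeness_from_dual {F : Type} [Field F] [Fintype F] [DecidableEq F]
    (n ℓ : ℕ) (hn : 0 < n) (hℓ : n ≤ ℓ)
    (V : Set (Submodule F (Fin n → F))) (hne : V.Nonempty)
    (hclosed : ∀ S ∈ V, ∀ T : Submodule F (Fin n → F), T ≤ S → T ∈ V)
    (k : ℕ)
    (hk : IsGreatest ((fun S : Submodule F (Fin n → F) => Module.finrank F ↥S) '' V) k) :
    (∃ β γ : Submodule F (Fin n → F) → ℝ,
        Feasible6 ℓ V ((Fintype.card F : ℝ) ^ (ℓ * k)) β γ) ∧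
    ∀ (α : ℝ) (β γ : Submodule F (Fin n → F) → ℝ),
        Feasible6 ℓ V α β γ → (Fintype.card F : ℝ) ^ (ℓ * k) ≤ α := by
  have hcard : ∀ S : Submodule F (Fin n → F),
      (Nat.card S : ℝ) ^ ℓ = (Fintype.card F : ℝ) ^ (ℓ * Module.finrank F S) := by
    intro S
    rw [Module.natCard_eq_pow_finrank (K := F), Nat.card_eq_fintype_card, Nat.cast_pow,
      ← pow_mul, mul_comm]
  obtain ⟨⟨S₀, hS₀, hS₀k⟩, hmax⟩ := hk
  constructor
  · have := Fintype.ofFinite (Submodule F (Fin n → F))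
    obtain ⟨β, hβ⟩ := exists_sum_ge_eq fun S : Submodule F (Fin n → F) =>
      ((Fintype.card F : ℝ) ^ ℓ) ^ (k - Module.finrank F S) - 1
    refine ⟨β, 0, nonneg_of_sum_ge_eq k ?_ β hβ, fun _ => le_rfl, fun S hS => ?_⟩
    · have hq : (1 : ℝ) ≤ Fintype.card F := by exact_mod_cast Fintype.card_pos
      simpa using pow_le_pow_right₀ hq hℓ
    · have hle : Module.finrank F S ≤ k := hmax ⟨S, hS, rfl⟩
      rw [hβ, hcard, ← pow_mul]
      obtain ⟨j, rfl⟩ := Nat.exists_eq_add_of_le hle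
      simp only [Pi.zero_apply, finsum_zero, Nat.add_sub_cancel_left, mul_add, pow_add]
      ring
  · rintro α β γ ⟨hβ, hγ, hfeas⟩
    dsimp only at hS₀k
    rw [hfeas S₀ hS₀, hcard, hS₀k]
    have h₁ : 0 ≤ ∑ᶠ (T : Submodule F (Fin n → F)) (_ : S₀ ≤ T), β T :=
      finsum_nonneg fun T => finsum_nonneg fun _ => hβ T
    have h₂ : 0 ≤ ∑ᶠ (T : Submodule F (Fin n → F)) (_ : T ≤ S₀), γ T :=
      finsum_nonneg fun T => finsum_nonneg fun _ => hγ T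
    have := mul_nonneg (pow_nonneg (Nat.cast_nonneg (α := ℝ) (Fintype.card F)) (ℓ * k)) h₁
    linarith
end

section
/- Nonnegativity of the completeness recurrence: Let q be a prime power and let k, n, ℓ be positive integers with k ≤ n ≤ ℓ. Define real numbers β̃_{k−1}, β̃_{k−2}, …, β̃_0 by the downward recurrence β̃_s = q^{ℓ(k−s)} − 1 − Σ_{i=s+1}^{k−1} C_q(n−s, i−s) · β̃_i (so β̃_{k−1} = q^ℓ − 1). Then β̃_s ≥ 0 for every s ∈ {0, 1, …, k−1}. -/
open scoped BigOperators

/-- The Gaussian binomial coefficient `C_q(a,b) = ∏_{j=0}^{b−1} (q^{a−j} − 1)/(q^{b−j} − 1)`. -/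
noncomputable def gaussBinom (q a b : ℕ) : ℝ :=
  ∏ j ∈ Finset.range b, ((q : ℝ) ^ (a - j) - 1) / ((q : ℝ) ^ (b - j) - 1)

/-- The product `∏_{i=1}^m (q^i − 1)`. -/
noncomputable def gaussFactorial (q m : ℕ) : ℝ :=
  ∏ i ∈ Finset.range m, ((q : ℝ) ^ (i + 1) - 1)

lemma pow_succ_sub_one_ge_one {q : ℕ} (hq : 2 ≤ q) (m : ℕ) : 1 ≤ (q : ℝ) ^ (m + 1) - 1 := by
  have h : (2 : ℝ) ≤ q := by exact_mod_cast hq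
  have h1 : (1 : ℝ) ≤ (q : ℝ) ^ m := one_le_pow₀ (by linarith)
  rw [pow_succ]
  nlinarith

lemma gaussFactorial_succ (q m : ℕ) :
    gaussFactorial q (m + 1) = gaussFactorial q m * ((q : ℝ) ^ (m + 1) - 1) :=
  Finset.prod_range_succ _ _

lemma gaussFactorial_ne_zero {q : ℕ} (hq : 2 ≤ q) (m : ℕ) : gaussFactorial q m ≠ 0 :=
  Finset.prod_ne_zero_iff.2 fun i _ => by linarith [pow_succ_sub_one_ge_one hq i]

lemma gaussBinom_zero_right (q a : ℕ) : gaussBinom q a 0 = 1 := by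
  simp [gaussBinom]

lemma gaussBinom_nonneg {q : ℕ} (hq : 2 ≤ q) (a b : ℕ) : 0 ≤ gaussBinom q a b := by
  have h : (1 : ℝ) ≤ q := by exact_mod_cast (by omega : 1 ≤ q)
  exact Finset.prod_nonneg fun j _ =>
    div_nonneg (sub_nonneg.2 (one_le_pow₀ h)) (sub_nonneg.2 (one_le_pow₀ h))

lemma gaussBinom_succ_succ (q a b : ℕ) :
    gaussBinom q (a + 1) (b + 1) =
      gaussBinom q a b * (((q : ℝ) ^ (a + 1) - 1) / ((q : ℝ) ^ (b + 1) - 1)) := by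
  simp [gaussBinom, Finset.prod_range_succ', div_mul_div_comm]

lemma gaussBinom_eq_zero_of_lt (q : ℕ) {a b : ℕ} (h : a < b) : gaussBinom q a b = 0 :=
  Finset.prod_eq_zero (Finset.mem_range.2 h) (by simp)

lemma gaussBinom_add_left {q : ℕ} (hq : 2 ≤ q) (d b : ℕ) :
    gaussBinom q (d + b) b =
      gaussFactorial q (d + b) / (gaussFactorial q b * gaussFactorial q d) := by
  induction b with
  | zero =>
    rw [add_zero, gaussBinom_zero_right, show gaussFactorial q 0 = 1 from Finset.prod_range_zero _,
      one_mul, div_self (gaussFactorial_ne_zero hq d)]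
  | succ b ih =>
    rw [← add_assoc, gaussBinom_succ_succ, ih, gaussFactorial_succ, gaussFactorial_succ,
      div_mul_div_comm]
    ring_nf

lemma gaussBinom_succ_right {q : ℕ} (hq : 2 ≤ q) {a b : ℕ} (h : b ≤ a) :
    gaussBinom q a (b + 1) =
      gaussBinom q a b * (((q : ℝ) ^ (a - b) - 1) / ((q : ℝ) ^ (b + 1) - 1)) := by
  obtain ⟨d, rfl⟩ := Nat.exists_eq_add_of_le' h
  cases d with
  | zero => simp [gaussBinom_eq_zero_of_lt]
  | succ d =>
    rw [gaussBinom_add_left hq, show d + 1 + b = d + (b + 1) by ring, gaussBinom_add_left hq,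
      show d + (b + 1) - b = d + 1 by omega, gaussFactorial_succ q d, gaussFactorial_succ q b]
    have h1 := gaussFactorial_ne_zero hq d
    have h2 := gaussFactorial_ne_zero hq b
    have h3 := pow_succ_sub_one_ge_one hq d
    have h4 := pow_succ_sub_one_ge_one hq b
    have h3' : (q : ℝ) ^ (d + 1) - 1 ≠ 0 := by linarith
    have h4' : (q : ℝ) ^ (b + 1) - 1 ≠ 0 := by linarith
    field_simp

/-- The `q`-Pascal rule. -/
lemma gaussBinom_pascal {q : ℕ} (hq : 2 ≤ q) {a b : ℕ} (h : b ≤ a) :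
    gaussBinom q (a + 1) (b + 1) =
      gaussBinom q a b + (q : ℝ) ^ (b + 1) * gaussBinom q a (b + 1) := by
  rw [gaussBinom_succ_succ, gaussBinom_succ_right hq h]
  have h4 := pow_succ_sub_one_ge_one hq b
  have h4' : (q : ℝ) ^ (b + 1) - 1 ≠ 0 := by linarith
  have h5 : (q : ℝ) ^ (a + 1) = (q : ℝ) ^ (b + 1) * (q : ℝ) ^ (a - b) := by
    rw [← pow_add]; congr 1; omega
  rw [h5]
  field_simp
  ring

lemma gaussBinom_mul_gaussBinom {q : ℕ} (hq : 2 ≤ q) {N i j : ℕ} (hji : j ≤ i) (hiN : i ≤ N) :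
    gaussBinom q N j * gaussBinom q (N - j) (i - j) = gaussBinom q N i * gaussBinom q i j := by
  obtain ⟨d, rfl⟩ := Nat.exists_eq_add_of_le' hji
  obtain ⟨e, rfl⟩ := Nat.exists_eq_add_of_le' hiN
  rw [show e + (d + j) - j = e + d by omega, show d + j - j = d by omega,
    gaussBinom_add_left hq, gaussBinom_add_left hq, gaussBinom_add_left hq, ← add_assoc,
    gaussBinom_add_left hq]
  have h1 := gaussFactorial_ne_zero hq d
  have h2 := gaussFactorial_ne_zero hq j
  have h3 := gaussFactorial_ne_zero hq e
  have h4 := gaussFactorial_ne_zero hq (d + j)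
  have h5 := gaussFactorial_ne_zero hq (e + d)
  field_simp

lemma sum_range_alternating_gaussBinom {q : ℕ} (hq : 2 ≤ q) {m r : ℕ} (h : r ≤ m + 1) :
    ∑ j ∈ Finset.range (r + 1), (-1 : ℝ) ^ j * ((q : ℝ) ^ j.choose 2 * gaussBinom q (m + 1) j) =
      (-1) ^ r * ((q : ℝ) ^ (r + 1).choose 2 * gaussBinom q m r) := by
  induction r with
  | zero => simp [gaussBinom_zero_right]
  | succ r ih =>
    rw [Finset.sum_range_succ, ih (by omega), gaussBinom_pascal hq (by omega),
      Nat.choose_succ_succ' (r + 1) 1, Nat.choose_one_right, pow_add]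
    ring

lemma sum_alternating_gaussBinom {q : ℕ} (hq : 2 ≤ q) (m : ℕ) :
    ∑ j ∈ Finset.range (m + 1), (-1 : ℝ) ^ j * ((q : ℝ) ^ j.choose 2 * gaussBinom q m j) =
      if m = 0 then 1 else 0 := by
  cases m with
  | zero => simp [gaussBinom_zero_right]
  | succ m =>
    rw [sum_range_alternating_gaussBinom hq le_rfl, gaussBinom_eq_zero_of_lt q m.lt_succ_self]
    simp

/-- Gaussian inversion. -/
lemma gaussBinom_inversion {q : ℕ} (hq : 2 ≤ q) {N t : ℕ} (ht : 0 < t) (htN : t ≤ N)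
    (c : ℕ → ℝ) :
    ∑ j ∈ Finset.range t, (-1 : ℝ) ^ j * ((q : ℝ) ^ j.choose 2 * gaussBinom q N j *
      ∑ i ∈ Finset.Ico j t, gaussBinom q (N - j) (i - j) * c i) = c 0 := by
  calc
    _ = ∑ j ∈ Finset.range t, ∑ i ∈ Finset.Ico j t, gaussBinom q N i * c i *
          ((-1 : ℝ) ^ j * ((q : ℝ) ^ j.choose 2 * gaussBinom q i j)) := by
      refine Finset.sum_congr rfl fun j _ => ?_
      rw [Finset.mul_sum, Finset.mul_sum]
      refine Finset.sum_congr rfl fun i hi => ?_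
      rw [Finset.mem_Ico] at hi
      linear_combination (-1 : ℝ) ^ j * (q : ℝ) ^ j.choose 2 * c i *
        gaussBinom_mul_gaussBinom hq hi.1 (hi.2.le.trans htN)
    _ = ∑ i ∈ Finset.range t, ∑ j ∈ Finset.range (i + 1), gaussBinom q N i * c i *
          ((-1 : ℝ) ^ j * ((q : ℝ) ^ j.choose 2 * gaussBinom q i j)) :=
      Finset.sum_comm' fun i j => by simp only [Finset.mem_range, Finset.mem_Ico]; omega
    _ = c 0 := by
      simp_rw [← Finset.mul_sum, sum_alternating_gaussBinom hq]
      simp [ht, gaussBinom_zero_right]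

lemma sum_alternating_mem_Icc {f : ℕ → ℝ} (hf : Antitone f) (h0 : ∀ j, 0 ≤ f j) (t : ℕ) :
    0 ≤ ∑ j ∈ Finset.range t, (-1 : ℝ) ^ j * f j ∧
      ∑ j ∈ Finset.range t, (-1 : ℝ) ^ j * f j ≤ f 0 := by
  induction t generalizing f with
  | zero => simpa using h0 0
  | succ t ih =>
    have h := ih (f := fun j => f (j + 1)) (fun a b hab => hf (by omega)) fun j => h0 _
    have h1 : f 1 ≤ f 0 := hf (by omega)
    rw [Finset.sum_range_succ']
    simp only [pow_succ, mul_neg, mul_one, neg_mul, Finset.sum_neg_distrib, pow_zero, one_mul]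
    simp only [zero_add] at h
    constructor <;> linarith [h.1, h.2]

lemma antitone_gaussBinom_mul {q : ℕ} (hq : 2 ≤ q) {N t ℓ : ℕ} (htN : t ≤ N) (hN : N ≤ ℓ) :
    Antitone fun j : ℕ =>
      (q : ℝ) ^ j.choose 2 * gaussBinom q N j * ((q : ℝ) ^ (ℓ * (t - j)) - 1) := by
  have hq1 : (1 : ℝ) ≤ q := by exact_mod_cast (by omega : 1 ≤ q)
  refine antitone_nat_of_succ_le fun j => ?_
  have hA : 0 ≤ (q : ℝ) ^ j.choose 2 * gaussBinom q N j :=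
    mul_nonneg (by positivity) (gaussBinom_nonneg hq _ _)
  rcases Nat.lt_or_ge j t with hj | hj
  · obtain ⟨u, rfl⟩ : ∃ u, t = u + 1 + j := ⟨t - j - 1, by omega⟩
    rw [gaussBinom_succ_right hq (by omega : j ≤ N), Nat.choose_succ_succ' j 1,
      Nat.choose_one_right, pow_add, show u + 1 + j - (j + 1) = u by omega,
      show u + 1 + j - j = u + 1 by omega, mul_add, mul_one, pow_add]
    have hD := pow_succ_sub_one_ge_one hq j
    have hX : 1 ≤ (q : ℝ) ^ (ℓ * u) := one_le_pow₀ hq1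
    have hQ : 1 ≤ (q : ℝ) ^ ℓ := one_le_pow₀ hq1
    have hB : (q : ℝ) ^ j * (((q : ℝ) ^ (N - j) - 1) / ((q : ℝ) ^ (j + 1) - 1)) ≤
        (q : ℝ) ^ ℓ := by
      rw [← mul_div_assoc, div_le_iff₀ (by linarith)]
      have h1 : (q : ℝ) ^ j * (q : ℝ) ^ (N - j) = (q : ℝ) ^ N := by
        rw [← pow_add]; congr 1; omega
      have h2 : (q : ℝ) ^ N ≤ (q : ℝ) ^ ℓ := pow_le_pow_right₀ hq1 hN
      have h3 : 0 ≤ (q : ℝ) ^ j := by positivity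
      nlinarith
    calc
      _ = (q : ℝ) ^ j.choose 2 * gaussBinom q N j *
          ((q : ℝ) ^ j * (((q : ℝ) ^ (N - j) - 1) / ((q : ℝ) ^ (j + 1) - 1)) *
            ((q : ℝ) ^ (ℓ * u) - 1)) := by ring
      _ ≤ _ := by
        refine mul_le_mul_of_nonneg_left ?_ hA
        linarith [mul_le_mul_of_nonneg_right hB (sub_nonneg.2 hX),
          pow_add (q : ℝ) (ℓ * u) ℓ]
  · rw [show t - (j + 1) = 0 by omega, show t - j = 0 by omega]
    simp

/-- **Nonnegativity of the completeness recurrence**: the numbers `β̃_s` defined by the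
downward recurrence `β̃_s = q^{ℓ(k−s)} − 1 − Σ_{i=s+1}^{k−1} C_q(n−s, i−s) β̃_i`
are nonnegative for all `s ∈ {0, …, k−1}`. -/
theorem recurrence_nonneg (q k n ℓ : ℕ) (hq : IsPrimePow q)
    (hk : 0 < k) (hkn : k ≤ n) (hnl : n ≤ ℓ)
    (b : ℕ → ℝ)
    (hb : ∀ s < k, b s = (q : ℝ) ^ (ℓ * (k - s)) - 1 -
        ∑ i ∈ Finset.Ico (s + 1) k, gaussBinom q (n - s) (i - s) * b i) :
    ∀ s < k, 0 ≤ b s := by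
  intro s hs
  have hq2 : 2 ≤ q := hq.two_le
  have hq1 : (1 : ℝ) ≤ q := by exact_mod_cast hq.one_lt.le
  have hsum : ∀ j ∈ Finset.range (k - s),
      ∑ i ∈ Finset.Ico j (k - s), gaussBinom q (n - s - j) (i - j) * b (s + i) =
        (q : ℝ) ^ (ℓ * (k - s - j)) - 1 := by
    intro j hj
    rw [Finset.mem_range] at hj
    have h1 := Finset.sum_Ico_add
      (fun i => gaussBinom q (n - s - j) (i - (s + j)) * b i) j (k - s) s
    simp only [Nat.add_sub_add_left] at h1
    rw [h1, show j + s = s + j by ring, show k - s + s = k by omega,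
      Finset.sum_eq_sum_Ico_succ_bot (by omega), Nat.sub_self, gaussBinom_zero_right, one_mul,
      hb (s + j) (by omega), Nat.sub_sub, Nat.sub_sub]
    ring
  have hinv := gaussBinom_inversion hq2 (by omega : 0 < k - s) (by omega : k - s ≤ n - s)
    fun i => b (s + i)
  rw [Finset.sum_congr rfl fun j hj => by rw [hsum j hj], add_zero] at hinv
  rw [← hinv]
  exact (sum_alternating_mem_Icc
    (antitone_gaussBinom_mul hq2 (by omega : k - s ≤ n - s) (by omega : n - s ≤ ℓ))
    (fun j => mul_nonneg (mul_nonneg (by positivity) (gaussBinom_nonneg hq2 _ _))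
      (sub_nonneg.2 (one_le_pow₀ hq1))) _).1
end

section
/- Joint configurations of pairs of matrices (Lemma 6.2): Let ℓ, n ∈ ℕ₊, let g, h ∈ Config_{n,ℓ} (over F_2), and let Y ∈ F_2^{ℓ×n} with config_{n,ℓ}(Y) = g. For X ∈ F_2^{ℓ×n} with config_{n,ℓ}(X) = h, define F_X : F_2^ℓ × F_2^ℓ → ℕ by F_X(u,v) = #{k ∈ [n] : the k-th column of X equals u and the k-th column of Y equals v}. Then: (i) F_X ∈ F_{g,h} for every such X; and (ii) for every F ∈ F_{g,h}, the number of X with config_{n,ℓ}(X) = h and F_X = F equals ∏_{v∈F_2^ℓ} ( g(v)! / ∏_{u∈F_2^ℓ} F(u,v)! ). -/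
open scoped BigOperators

/-- The configuration of a matrix: `config X u` is the number of columns of `X` equal to `u`. -/
def config {ℓ n : ℕ}
    (X : Matrix (Fin ℓ) (Fin n) (ZMod 2)) (u : Fin ℓ → ZMod 2) : ℕ :=
  (Finset.univ.filter fun k : Fin n => ∀ i, X i k = u i).card

/-- `F_{g,h}`: functions `F : F_2^ℓ × F_2^ℓ → ℕ` with `Σ_u F(u,v) = g(v)` and `Σ_v F(u,v) = h(u)`. -/
def Fgh {ℓ : ℕ} (g h : (Fin ℓ → ZMod 2) → ℕ) :
    Set ((Fin ℓ → ZMod 2) → (Fin ℓ → ZMod 2) → ℕ) :=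
  {F | (∀ v, ∑ u, F u v = g v) ∧ ∀ u, ∑ v, F u v = h u}

/-- The joint configuration of `X` and `Y`: `jointConfig X Y u v` is the number of indices `k`
such that the `k`-th column of `X` is `u` and the `k`-th column of `Y` is `v`. -/
def jointConfig {ℓ n : ℕ} (X Y : Matrix (Fin ℓ) (Fin n) (ZMod 2))
    (u v : Fin ℓ → ZMod 2) : ℕ :=
  (Finset.univ.filter fun k : Fin n => (∀ i, X i k = u i) ∧ ∀ i, Y i k = v i).card

open Finset in
/-- The number of functions with prescribed fibre sizes is a multinomial coefficient. -/
theorem card_filter_fiber_card_eq {α β : Type*} [Fintype α] [DecidableEq α] [Fintype β]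
    [DecidableEq β] (c : β → ℕ) (hc : ∑ b, c b = Fintype.card α) :
    #{f : α → β | ∀ b, #{a | f a = b} = c b} = Nat.multinomial univ c := by
  have hX (d : β → ℕ) : (MvPolynomial.coeff (Finsupp.equivFunOnFinite.symm c)
      (∏ b, (MvPolynomial.X b : MvPolynomial β ℕ) ^ d b)) = if d = c then 1 else 0 := by
    have h : Finsupp.indicator univ (fun i _ => d i) = Finsupp.equivFunOnFinite.symm d := by
      ext; simp [Finsupp.indicator]
    rw [MvPolynomial.prod_X_pow, MvPolynomial.coeff_monomial, h]
    simp
  have hfun : (∑ b, (MvPolynomial.X b : MvPolynomial β ℕ)) ^ Fintype.card α =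
      ∑ f : α → β, ∏ b, MvPolynomial.X b ^ #{a | f a = b} := by
    rw [← card_univ, ← prod_const, prod_univ_sum, Fintype.piFinset_univ]
    refine sum_congr rfl fun f _ => ?_
    rw [← prod_fiberwise' univ f]
    simp only [prod_const]
  have key := congrArg (MvPolynomial.coeff (Finsupp.equivFunOnFinite.symm c))
    (hfun.symm.trans (sum_pow_eq_sum_piAntidiag univ _ _))
  simp only [← map_natCast (MvPolynomial.C : ℕ →+* MvPolynomial β ℕ), MvPolynomial.coeff_sum,
    MvPolynomial.coeff_C_mul, hX] at key
  simp only [sum_boole, mul_ite, mul_one, mul_zero, sum_ite_eq', mem_piAntidiag, hc, mem_univ,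
    implies_true, and_self, if_true] at key
  simpa [funext_iff] using key

open Finset in
/-- The number of functions `f` whose joint fibre sizes with a given function `y` are prescribed
is a product of multinomial coefficients. -/
theorem card_filter_joint_fiber_card_eq {κ β γ : Type*} [Fintype κ] [DecidableEq κ] [Fintype β]
    [DecidableEq β] [Fintype γ] [DecidableEq γ] (y : κ → γ) (F : β → γ → ℕ)
    (hF : ∀ v, ∑ u, F u v = #{k | y k = v}) :
    #{f : κ → β | ∀ u v, #{k | f k = u ∧ y k = v} = F u v} =
      ∏ v, Nat.multinomial univ (F · v) := by
  let e : (κ → β) ≃ ((v : γ) → {k // y k = v} → β) :=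
    ((Equiv.sigmaFiberEquiv y).arrowCongr (Equiv.refl β)).symm.trans
      (Equiv.piCurry fun _ _ => β)
  have hfib (f : κ → β) (u : β) (v : γ) :
      #{k : {k // y k = v} | e f v k = u} = #{k | f k = u ∧ y k = v} := by
    refine card_bij (fun k _ => k.1) ?_ (fun _ _ _ _ h => Subtype.ext h) ?_
    · rintro ⟨k, hk⟩ h
      exact mem_filter.2 ⟨mem_univ _, (mem_filter.1 h).2, hk⟩
    · intro k h
      obtain ⟨-, hu, hv⟩ := mem_filter.1 h
      exact ⟨⟨k, hv⟩, mem_filter.2 ⟨mem_univ _, hu⟩, rfl⟩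
  calc
    _ = #(Fintype.piFinset fun v : γ =>
          {p : {k // y k = v} → β | ∀ u, #{k | p k = u} = F u v}) := by
      refine card_equiv e fun f => ?_
      simp only [mem_filter, mem_univ, true_and, Fintype.mem_piFinset, hfib]
      exact forall_comm
    _ = _ := by
      rw [Fintype.card_piFinset]
      refine prod_congr rfl fun v _ => card_filter_fiber_card_eq _ ?_
      rw [hF, Fintype.card_subtype]

/-- Summing the joint configuration over its first argument gives the configuration of `Y`. -/
theorem sum_jointConfig_left {ℓ n : ℕ} (X Y : Matrix (Fin ℓ) (Fin n) (ZMod 2))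
    (v : Fin ℓ → ZMod 2) : ∑ u, jointConfig X Y u v = config Y v := by
  simp only [jointConfig, config, ← funext_iff (f := fun i => X i _)]
  rw [Finset.card_eq_sum_card_fiberwise (f := fun k i => X i k) (t := Finset.univ) (by simp)]
  simp [Finset.filter_filter, and_comm]

/-- Summing the joint configuration over its second argument gives the configuration of `X`. -/
theorem sum_jointConfig_right {ℓ n : ℕ} (X Y : Matrix (Fin ℓ) (Fin n) (ZMod 2))
    (u : Fin ℓ → ZMod 2) : ∑ v, jointConfig X Y u v = config X u := by
  rw [← sum_jointConfig_left Y X u]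
  simp [jointConfig, and_comm]

/-- **Joint configurations of pairs of matrices** (Lemma 6.2):
(i) `F_X ∈ F_{g,h}`; (ii) for every `F ∈ F_{g,h}`, the number of `X` with
`config X = h` and `F_X = F` is `∏_v (g(v)! / ∏_u F(u,v)!)`. -/
theorem joint_config_count (ℓ n : ℕ) (hℓ : 0 < ℓ) (hn : 0 < n)
    (g h : (Fin ℓ → ZMod 2) → ℕ) (hgsum : ∑ u, g u = n) (hhsum : ∑ u, h u = n)
    (Y : Matrix (Fin ℓ) (Fin n) (ZMod 2)) (hY : config Y = g) :
    (∀ X : Matrix (Fin ℓ) (Fin n) (ZMod 2), config X = h → jointConfig X Y ∈ Fgh g h) ∧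
    ∀ Fc ∈ Fgh g h,
      (Finset.univ.filter fun X : Matrix (Fin ℓ) (Fin n) (ZMod 2) =>
          config X = h ∧ jointConfig X Y = Fc).card =
        ∏ v, ((g v).factorial / ∏ u, (Fc u v).factorial) := by
  subst hY
  refine ⟨fun X hX => ⟨sum_jointConfig_left X Y, fun u => hX ▸ sum_jointConfig_right X Y u⟩,
    fun F hF => ?_⟩
  have hcount := card_filter_joint_fiber_card_eq (fun k i => Y i k) F fun v => by
    simpa [config, funext_iff] using hF.1 v
  calc
    _ = _ := by
      refine Finset.card_equiv (Equiv.piComm fun _ _ => ZMod 2) fun X => ?_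
      have hX : jointConfig X Y = F → config X = h := fun hJ => by
        ext u
        rw [← sum_jointConfig_right X Y u, hJ, hF.2]
      simp only [Finset.mem_filter, Finset.mem_univ, true_and, and_iff_right_of_imp hX]
      simp [funext_iff, jointConfig]
      rfl
    _ = _ := hcount
    _ = _ := by simp only [Nat.multinomial, hF.1]
end

section
/- Sign of φ_{m,u} when some combination vanishes (Lemma 6.4(i)): Let ℓ, n ∈ ℕ₊, ε ∈ (0,1), and let m be an even natural number with m ≥ (ℓ−1)/lg(1/ε), where lg is the base-2 logarithm. If X ∈ Valid^ε_{n,ℓ}, u ∈ F_2^ℓ \ {0}, and there exists v ∈ F_2^ℓ with ⟨u,v⟩ = 1 and vX = 0, then φ_{m,u}(X) ≥ 0. -/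
open scoped BigOperators

/-- Hamming weight of a vector over `F_2`. -/
def wt {n : ℕ} (x : Fin n → ZMod 2) : ℕ :=
  (Finset.univ.filter fun k => x k ≠ 0).card

/-- The set `Valid^ε_{n,ℓ}` of `ε`-balanced matrices: every nonzero `F_2`-linear combination of
the rows has Hamming weight between `(1−ε)n/2` and `(1+ε)n/2`. -/
def ValidEps (ℓ n : ℕ) (ε : ℝ) : Set (Matrix (Fin ℓ) (Fin n) (ZMod 2)) :=
  {X | ∀ u : Fin ℓ → ZMod 2, Matrix.vecMul u X ≠ 0 →
    (1 - ε) * n / 2 ≤ (wt (Matrix.vecMul u X) : ℝ) ∧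
      (wt (Matrix.vecMul u X) : ℝ) ≤ (1 + ε) * n / 2}

/-- `φ_{m,u}(X) = Σ_{v : ⟨u,v⟩=1} ((n − 2|vX|)^m − (εn)^m)`. -/
noncomputable def phi (ℓ n : ℕ) (ε : ℝ) (m : ℕ) (u : Fin ℓ → ZMod 2)
    (X : Matrix (Fin ℓ) (Fin n) (ZMod 2)) : ℝ :=
  ∑ v ∈ Finset.univ.filter (fun v : Fin ℓ → ZMod 2 => ∑ j, u j * v j = 1),
    (((n : ℝ) - 2 * (wt (Matrix.vecMul v X) : ℝ)) ^ m - (ε * n) ^ m)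

/-- `Φ_m = ∏_{u ≠ 0} φ_{m,u}`. -/
noncomputable def Phi (ℓ n : ℕ) (ε : ℝ) (m : ℕ)
    (X : Matrix (Fin ℓ) (Fin n) (ZMod 2)) : ℝ :=
  ∏ u ∈ Finset.univ.filter (fun u : Fin ℓ → ZMod 2 => u ≠ 0), phi ℓ n ε m u X

/-- An affine hyperplane of `F_2^ℓ` avoiding the origin contains at most half of the points. -/
lemma two_mul_card_filter_dot_eq_one_le {ℓ : ℕ} (u v : Fin ℓ → ZMod 2)
    (huv : ∑ j, u j * v j = 1) :
    2 * (Finset.univ.filter fun w : Fin ℓ → ZMod 2 => ∑ j, u j * w j = 1).card ≤ 2 ^ ℓ := by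
  have hle : (Finset.univ.filter fun w : Fin ℓ → ZMod 2 => ∑ j, u j * w j = 1).card ≤
      (Finset.univ.filter fun w : Fin ℓ → ZMod 2 => ¬ ∑ j, u j * w j = 1).card := by
    refine Finset.card_le_card_of_injOn (fun w => w + v) (fun w hw => ?_)
      (fun _ _ _ _ h => add_right_cancel h)
    have hw' : ∑ j, u j * w j = 1 := by simpa using hw
    simp [mul_add, Finset.sum_add_distrib, hw', huv]
  have hsum := Finset.card_filter_add_card_filter_not (s := Finset.univ)
    (fun w : Fin ℓ → ZMod 2 => ∑ j, u j * w j = 1)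
  have hcard : (Finset.univ : Finset (Fin ℓ → ZMod 2)).card = 2 ^ ℓ := by simp
  omega

/-- An exponent `m ≥ (ℓ - 1) / lg (1 / ε)` makes `2 ^ ℓ * ε ^ m` at most `2`. -/
lemma two_pow_mul_pow_le_two {ℓ m : ℕ} {ε : ℝ} (hε0 : 0 < ε) (hε1 : ε < 1)
    (hm : ((ℓ : ℝ) - 1) / Real.logb 2 (1 / ε) ≤ (m : ℝ)) :
    (2 : ℝ) ^ ℓ * ε ^ m ≤ 2 := by
  have hpos : 0 < Real.logb 2 (1 / ε) :=
    Real.logb_pos one_lt_two ((one_lt_div hε0).2 hε1)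
  rw [div_le_iff₀ hpos, one_div, Real.logb_inv] at hm
  rw [← Real.logb_le_logb one_lt_two (by positivity) two_pos,
    Real.logb_mul (by positivity) (by positivity), Real.logb_pow, Real.logb_pow,
    Real.logb_self_eq_one one_lt_two]
  linarith

/-- **Sign of `φ_{m,u}` when some combination vanishes** (Lemma 6.4(i)). -/
theorem phi_nonneg_of_exists_zero (ℓ n : ℕ) (hℓ : 0 < ℓ) (hn : 0 < n)
    (ε : ℝ) (hε0 : 0 < ε) (hε1 : ε < 1)
    (m : ℕ) (hmeven : Even m)
    (hm : ((ℓ : ℝ) - 1) / Real.logb 2 (1 / ε) ≤ (m : ℝ))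
    (X : Matrix (Fin ℓ) (Fin n) (ZMod 2)) (hX : X ∈ ValidEps ℓ n ε)
    (u : Fin ℓ → ZMod 2) (hu : u ≠ 0)
    (v : Fin ℓ → ZMod 2) (huv : ∑ j, u j * v j = 1) (hvX : Matrix.vecMul v X = 0) :
    0 ≤ phi ℓ n ε m u X := by
  set S := Finset.univ.filter fun w : Fin ℓ → ZMod 2 => ∑ j, u j * w j = 1 with hS
  have hsum : (n : ℝ) ^ m ≤ ∑ w ∈ S, ((n : ℝ) - 2 * (wt (Matrix.vecMul w X) : ℝ)) ^ m := by
    have hv : v ∈ S := by simp [hS, huv]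
    simpa [hvX, wt] using Finset.single_le_sum
      (f := fun w => ((n : ℝ) - 2 * (wt (Matrix.vecMul w X) : ℝ)) ^ m)
      (fun w _ => hmeven.pow_nonneg _) hv
  have hcard : 2 * (S.card : ℝ) ≤ 2 ^ ℓ := by
    exact_mod_cast two_mul_card_filter_dot_eq_one_le u v huv
  have hsmall : (S.card : ℝ) * ε ^ m ≤ 1 := by
    have hmul := mul_le_mul_of_nonneg_right hcard (pow_nonneg hε0.le m)
    linarith [two_pow_mul_pow_le_two hε0 hε1 hm]
  have hscaled := mul_le_mul_of_nonneg_right hsmall (by positivity : (0 : ℝ) ≤ (n : ℝ) ^ m)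
  rw [phi, Finset.sum_sub_distrib, Finset.sum_const, nsmul_eq_mul, mul_pow]
  linarith
end

section
/- Sign of φ_{m,u} when no combination vanishes (Lemma 6.4(ii)): Let ℓ, n ∈ ℕ₊, ε ∈ (0,1), and let m be an even natural number with m ≥ (ℓ−1)/lg(1/ε), where lg is the base-2 logarithm. If X ∈ Valid^ε_{n,ℓ}, u ∈ F_2^ℓ \ {0}, and vX ≠ 0 for every v ∈ F_2^ℓ with ⟨u,v⟩ = 1, then φ_{m,u}(X) ≤ 0. -/
open scoped BigOperators

/-- **Sign of `φ_{m,u}` when no combination vanishes** (Lemma 6.4(ii)). -/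
theorem phi_nonpos_of_forall_ne_zero (ℓ n : ℕ) (hℓ : 0 < ℓ) (hn : 0 < n)
    (ε : ℝ) (hε0 : 0 < ε) (hε1 : ε < 1)
    (m : ℕ) (hmeven : Even m)
    (hm : ((ℓ : ℝ) - 1) / Real.logb 2 (1 / ε) ≤ (m : ℝ))
    (X : Matrix (Fin ℓ) (Fin n) (ZMod 2)) (hX : X ∈ ValidEps ℓ n ε)
    (u : Fin ℓ → ZMod 2) (hu : u ≠ 0)
    (hall : ∀ v : Fin ℓ → ZMod 2, (∑ j, u j * v j = 1) → Matrix.vecMul v X ≠ 0) :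
    phi ℓ n ε m u X ≤ 0 := by
  refine Finset.sum_nonpos fun v hv => sub_nonpos.2 ?_
  obtain ⟨h_lower, h_upper⟩ := hX v (hall v (Finset.mem_filter.1 hv).2)
  rw [← hmeven.pow_abs]
  exact pow_le_pow_left₀ (abs_nonneg _) (abs_le.2 ⟨by linarith, by linarith⟩) m
end

section
/- Feasibility of the spectral dual construction (feasibility part of Theorem 6.7): Let ℓ, n ∈ ℕ₊, ε ∈ (0,1), and let m be an even positive integer with m ≥ (ℓ−1)/lg(1/ε) (lg the base-2 logarithm). Let G : F_2^ℓ → ℝ satisfy G(u) > 0 for all u, Σ_{u∈F_2^ℓ} G(u) = 1, and n·G(u) ∈ ℕ for all u. Let Λ : F_2^{ℓ×n} → ℝ be the indicator of {X : config_{n,ℓ}(X) = n·G}, and suppose that for every i ∈ F_2^ℓ\{0} there exists v ∈ F_2^ℓ with ⟨i,v⟩ = 1 such that (A_v^m Λ)(X) ≥ (2^{2ℓ−1} ε^m n^m + 1) Λ(X) for every X ∈ F_2^{ℓ×n}. Define F = Φ_m · Λ̂² (pointwise product, Λ̂² the pointwise square of the Fourier transform of Λ). Then F̂(0) > 0, and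 the function f = F / F̂(0) satisfies: f̂(0) = 1; f̂(X) ≥ 0 for every X ∈ F_2^{ℓ×n}; and f(X) ≤ 0 for every X ∈ Valid^ε_{n,ℓ} \ {0}. In other words, f is a feasible solution of the level-ℓ dual Delsarte LP for ε-balanced binary linear codes. -/
open scoped BigOperators

/-- The configuration `h_v` with `h_v(v) = 1`, `h_v(0) = n−1` and `h_v(u) = 0` otherwise. -/
def hv {ℓ : ℕ} (n : ℕ) (v : Fin ℓ → ZMod 2) : (Fin ℓ → ZMod 2) → ℕ :=
  fun u => if u = v then 1 else if u = 0 then n - 1 else 0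

/-- The adjacency operator `A_v`: `(A_v f)(y) = Σ_{x : x−y has one column `v`, rest zero} f(x)`. -/
def AvOp {ℓ n : ℕ} (v : Fin ℓ → ZMod 2)
    (f : Matrix (Fin ℓ) (Fin n) (ZMod 2) → ℝ) (y : Matrix (Fin ℓ) (Fin n) (ZMod 2)) : ℝ :=
  ∑ x ∈ Finset.univ.filter
      (fun x : Matrix (Fin ℓ) (Fin n) (ZMod 2) => config (x - y) = hv n v), f x

/-- The Fourier transform over `F_2^{ℓ×n}`:
`f̂(Y) = 2^{−nℓ} Σ_X f(X) (−1)^{Σ_{j,k} X_{jk}Y_{jk}}`. -/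
noncomputable def ft {ℓ n : ℕ} (f : Matrix (Fin ℓ) (Fin n) (ZMod 2) → ℝ)
    (Y : Matrix (Fin ℓ) (Fin n) (ZMod 2)) : ℝ :=
  ((2 : ℝ) ^ (n * ℓ))⁻¹ *
    ∑ X, f X * (-1 : ℝ) ^ (∑ j, ∑ k, X j k * Y j k : ZMod 2).val

lemma zmod_two_eq_zero_or_one : ∀ a : ZMod 2, a = 0 ∨ a = 1 := by decide

/-- The sign character `a ↦ (-1)^a` of `F_2`. -/
noncomputable def signChar (a : ZMod 2) : ℝ := (-1 : ℝ) ^ a.val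

lemma signChar_zero : signChar 0 = 1 := by simp [signChar]

lemma signChar_eq (a : ZMod 2) : signChar a = if a ≠ 0 then -1 else 1 := by
  obtain rfl | rfl := zmod_two_eq_zero_or_one a <;> simp [signChar, ZMod.val_one]

lemma signChar_add (a b : ZMod 2) : signChar (a + b) = signChar a * signChar b := by
  have h11 : (1 + 1 : ZMod 2) = 0 := by decide
  obtain rfl | rfl := zmod_two_eq_zero_or_one a <;>
    obtain rfl | rfl := zmod_two_eq_zero_or_one b <;> simp [signChar_eq, h11]

/-- The pairing `Σ_{j,k} X_{jk} Y_{jk}` of matrices over `F_2`. -/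
def matPair {ℓ n : ℕ} (X Y : Matrix (Fin ℓ) (Fin n) (ZMod 2)) : ZMod 2 :=
  ∑ j, ∑ k, X j k * Y j k

section Pairing

variable {ℓ n : ℕ}

lemma matPair_add_left (X Z Y : Matrix (Fin ℓ) (Fin n) (ZMod 2)) :
    matPair (X + Z) Y = matPair X Y + matPair Z Y := by
  simp [matPair, add_mul, Finset.sum_add_distrib]

lemma matPair_comm (X Y : Matrix (Fin ℓ) (Fin n) (ZMod 2)) : matPair X Y = matPair Y X := by
  simp [matPair, mul_comm]

lemma matPair_add_right (X Y Z : Matrix (Fin ℓ) (Fin n) (ZMod 2)) :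
    matPair X (Y + Z) = matPair X Y + matPair X Z := by
  rw [matPair_comm, matPair_add_left, matPair_comm Y, matPair_comm Z]

lemma ft_eq_signChar (f : Matrix (Fin ℓ) (Fin n) (ZMod 2) → ℝ)
    (Y : Matrix (Fin ℓ) (Fin n) (ZMod 2)) :
    ft f Y = ((2 : ℝ) ^ (n * ℓ))⁻¹ * ∑ X, f X * signChar (matPair X Y) := rfl

lemma sum_signChar_nonneg (Z : Matrix (Fin ℓ) (Fin n) (ZMod 2)) :
    0 ≤ ∑ Y, signChar (matPair Z Y) := by
  by_cases h : ∃ W, matPair Z W ≠ 0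
  · obtain ⟨W, hW⟩ := h
    have h1 : ∑ Y, signChar (matPair Z (Y + W)) = ∑ Y, signChar (matPair Z Y) :=
      Equiv.sum_comp (Equiv.addRight W) fun Y => signChar (matPair Z Y)
    simp_rw [matPair_add_right, signChar_add, ← Finset.sum_mul] at h1
    rw [signChar_eq (matPair Z W), if_pos hW] at h1
    linarith
  · push Not at h
    exact Finset.sum_nonneg fun Y _ => by rw [h Y, signChar_zero]; norm_num

lemma ft_mul_ft (g h : Matrix (Fin ℓ) (Fin n) (ZMod 2) → ℝ)
    (X : Matrix (Fin ℓ) (Fin n) (ZMod 2)) :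
    ft (fun Y => ft g Y * ft h Y) X = ((2 : ℝ) ^ (n * ℓ))⁻¹ ^ 3 *
      ∑ a, ∑ b, g a * h b * ∑ Y, signChar (matPair (a + b + X) Y) := by
  have key : ∑ Y, (∑ a, g a * signChar (matPair a Y)) * (∑ b, h b * signChar (matPair b Y)) *
      signChar (matPair Y X) = ∑ a, ∑ b, g a * h b * ∑ Y, signChar (matPair (a + b + X) Y) := by
    simp_rw [Finset.sum_mul_sum, Finset.sum_mul, Finset.mul_sum]
    rw [Finset.sum_comm]
    refine Finset.sum_congr rfl fun a _ => ?_
    rw [Finset.sum_comm]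
    refine Finset.sum_congr rfl fun b _ => Finset.sum_congr rfl fun Y _ => ?_
    rw [matPair_add_left, matPair_add_left, signChar_add, signChar_add, matPair_comm Y X]
    ring
  rw [← key, ft_eq_signChar, Finset.mul_sum, Finset.mul_sum]
  refine Finset.sum_congr rfl fun Y _ => ?_
  rw [ft_eq_signChar, ft_eq_signChar]
  ring

lemma ft_mul_ft_nonneg {g h : Matrix (Fin ℓ) (Fin n) (ZMod 2) → ℝ} (hg : 0 ≤ g) (hh : 0 ≤ h)
    (X : Matrix (Fin ℓ) (Fin n) (ZMod 2)) : 0 ≤ ft (fun Y => ft g Y * ft h Y) X := by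
  rw [ft_mul_ft]
  exact mul_nonneg (by positivity) (Finset.sum_nonneg fun a _ => Finset.sum_nonneg fun b _ =>
    mul_nonneg (mul_nonneg (hg a) (hh b)) (sum_signChar_nonneg _))

lemma ft_mul_ft_zero_pos {g h : Matrix (Fin ℓ) (Fin n) (ZMod 2) → ℝ} (hg : 0 ≤ g) (hh : 0 ≤ h)
    {a : Matrix (Fin ℓ) (Fin n) (ZMod 2)} (hga : 0 < g a) (hha : 0 < h a) :
    0 < ft (fun Y => ft g Y * ft h Y) 0 := by
  have hnn : ∀ x y, 0 ≤ g x * h y * ∑ Y, signChar (matPair (x + y + 0) Y) := fun x y =>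
    mul_nonneg (mul_nonneg (hg x) (hh y)) (sum_signChar_nonneg _)
  rw [ft_mul_ft]
  have hinner : ∀ x, 0 ≤ ∑ y, g x * h y * ∑ Y, signChar (matPair (x + y + 0) Y) := fun x =>
    Finset.sum_nonneg fun y _ => hnn x y
  refine mul_pos (by positivity) (Finset.sum_pos' (fun x _ => hinner x)
    ⟨a, Finset.mem_univ _, Finset.sum_pos' (fun y _ => hnn a y) ⟨a, Finset.mem_univ _, ?_⟩⟩)
  have haa : a + a = 0 := by
    ext i j
    exact CharTwo.add_self_eq_zero _
  have hone : ∀ Y : Matrix (Fin ℓ) (Fin n) (ZMod 2), signChar (matPair (a + a + 0) Y) = 1 := by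
    intro Y
    rw [haa, add_zero]
    simp [matPair, signChar_zero]
  simp_rw [hone]
  refine mul_pos (mul_pos hga hha) ?_
  simp only [Finset.sum_const, nsmul_eq_mul, mul_one, Nat.cast_pos]
  exact Finset.card_pos.2 ⟨0, Finset.mem_univ _⟩

/-- The Fourier transform as a linear map. -/
noncomputable def ftLin (ℓ n : ℕ) :
    Module.End ℝ (Matrix (Fin ℓ) (Fin n) (ZMod 2) → ℝ) where
  toFun f := ft f
  map_add' f g := by
    funext Y
    simp [ft_eq_signChar, add_mul, Finset.sum_add_distrib, mul_add]
  map_smul' c f := by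
    funext Y
    simp only [ft_eq_signChar, Pi.smul_apply, smul_eq_mul, RingHom.id_apply, mul_assoc,
      ← Finset.mul_sum]
    ring

end Pairing

section Adjacency

variable {ℓ n : ℕ}

lemma AvOp_eq_sum_add (v : Fin ℓ → ZMod 2) (f : Matrix (Fin ℓ) (Fin n) (ZMod 2) → ℝ)
    (y : Matrix (Fin ℓ) (Fin n) (ZMod 2)) :
    AvOp v f y = ∑ d ∈ Finset.univ.filter
      (fun d : Matrix (Fin ℓ) (Fin n) (ZMod 2) => config d = hv n v), f (d + y) := by
  refine Finset.sum_nbij' (fun x => x - y) (fun d => d + y) ?_ ?_ ?_ ?_ ?_ <;> simp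

/-- `A_v` as a linear map. -/
def AvLin (n : ℕ) (v : Fin ℓ → ZMod 2) :
    Module.End ℝ (Matrix (Fin ℓ) (Fin n) (ZMod 2) → ℝ) where
  toFun f := AvOp v f
  map_add' f g := by
    funext Y
    simp [AvOp, Finset.sum_add_distrib]
  map_smul' c f := by
    funext Y
    simp [AvOp, Finset.mul_sum]

lemma AvLin_commute (v w : Fin ℓ → ZMod 2) : Commute (AvLin n v) (AvLin n w) := by
  refine LinearMap.ext fun f => funext fun y => ?_
  change AvOp v (AvOp w f) y = AvOp w (AvOp v f) y
  simp_rw [AvOp_eq_sum_add]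
  rw [Finset.sum_comm]
  simp_rw [add_left_comm]

lemma AvLin_nonneg (v : Fin ℓ → ZMod 2) {f : Matrix (Fin ℓ) (Fin n) (ZMod 2) → ℝ} (hf : 0 ≤ f) :
    0 ≤ AvLin n v f := fun _ => Finset.sum_nonneg fun x _ => hf x

lemma AvLin_pow_nonneg (v : Fin ℓ → ZMod 2) (m : ℕ) {f : Matrix (Fin ℓ) (Fin n) (ZMod 2) → ℝ}
    (hf : 0 ≤ f) : 0 ≤ (AvLin n v ^ m) f := by
  induction m with
  | zero => simpa using hf
  | succ m ih =>
    rw [pow_succ']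
    exact AvLin_nonneg v ih

/-- The matrix whose `k`-th column is `v` and whose other columns vanish. -/
def colMat (v : Fin ℓ → ZMod 2) (k : Fin n) : Matrix (Fin ℓ) (Fin n) (ZMod 2) :=
  fun i k' => if k' = k then v i else 0

lemma config_eq_hv_iff {v : Fin ℓ → ZMod 2} (hv0 : v ≠ 0)
    (d : Matrix (Fin ℓ) (Fin n) (ZMod 2)) : config d = hv n v ↔ ∃ k, colMat v k = d := by
  constructor
  · intro h
    have h1 : config d v = 1 := by rw [h]; simp [hv]
    obtain ⟨k, hk⟩ := Finset.card_eq_one.1 h1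
    have hmem : ∀ k', (∀ i, d i k' = v i) ↔ k' = k := fun k' => by
      simpa using Finset.ext_iff.1 hk k'
    refine ⟨k, ?_⟩
    ext i k'
    by_cases hkk : k' = k
    · simp [colMat, hkk, (hmem k).2 rfl i]
    · have hne : (fun i => d i k') ≠ v := fun e => hkk ((hmem k').1 fun i => congrFun e i)
      have hz : (fun i => d i k') = 0 := by
        by_contra hne0
        have h0 : config d (fun i => d i k') = 0 := by rw [h]; simp [hv, hne, hne0]
        have := Finset.card_eq_zero.1 h0
        exact (Finset.eq_empty_iff_forall_notMem.1 this k') (by simp)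
      simpa [colMat, hkk] using (congrFun hz i).symm
  · rintro ⟨k, rfl⟩
    have hcol : ∀ (u : Fin ℓ → ZMod 2) (k' : Fin n),
        (∀ i, colMat v k i k' = u i) ↔ (if k' = k then v else 0) = u := fun u k' => by
      by_cases hkk : k' = k <;> simp [colMat, hkk, funext_iff]
    funext u
    simp only [config, hv, hcol]
    by_cases huv : u = v
    · subst huv
      have : (Finset.univ.filter fun k' => (if k' = k then u else 0) = u) = {k} := by
        ext k'
        by_cases hkk : k' = k <;> simp [hkk, hv0.symm]
      rw [this, if_pos rfl, Finset.card_singleton]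
    · by_cases hu0 : u = 0
      · subst hu0
        have : (Finset.univ.filter fun k' => (if k' = k then v else 0) = 0) =
            Finset.univ.erase k := by
          ext k'
          by_cases hkk : k' = k <;> simp [hkk, hv0]
        rw [this, if_neg huv, if_pos rfl, Finset.card_erase_of_mem (Finset.mem_univ k),
          Finset.card_fin]
      · have : (Finset.univ.filter fun k' => (if k' = k then v else 0) = u) = ∅ := by
          ext k'
          by_cases hkk : k' = k <;> simp [hkk, Ne.symm huv, Ne.symm hu0]
        rw [this, if_neg huv, if_neg hu0, Finset.card_empty]

lemma colMat_injective {v : Fin ℓ → ZMod 2} (hv0 : v ≠ 0) :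
    Function.Injective (colMat (n := n) v) := by
  intro k k' h
  obtain ⟨i, hi⟩ := Function.ne_iff.1 hv0
  by_contra hne
  have := congrFun (congrFun h i) k
  simp only [colMat, if_true, if_neg hne] at this
  exact hi this

lemma matPair_colMat (v : Fin ℓ → ZMod 2) (k : Fin n) (Y : Matrix (Fin ℓ) (Fin n) (ZMod 2)) :
    matPair (colMat v k) Y = Matrix.vecMul v Y k := by
  simp [matPair, colMat, Matrix.vecMul, dotProduct]

lemma sum_signChar_eq_wt (x : Fin n → ZMod 2) : ∑ k, signChar (x k) = n - 2 * (wt x : ℝ) := by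
  have h : ∀ k, signChar (x k) = 1 - 2 * if x k ≠ 0 then (1 : ℝ) else 0 := fun k => by
    rw [signChar_eq]; split_ifs <;> norm_num
  simp_rw [h, Finset.sum_sub_distrib, ← Finset.mul_sum, Finset.sum_boole]
  simp [wt]

lemma sum_signChar_config {v : Fin ℓ → ZMod 2} (hv0 : v ≠ 0)
    (Y : Matrix (Fin ℓ) (Fin n) (ZMod 2)) :
    ∑ d ∈ Finset.univ.filter
      (fun d : Matrix (Fin ℓ) (Fin n) (ZMod 2) => config d = hv n v), signChar (matPair d Y) =
      n - 2 * (wt (Matrix.vecMul v Y) : ℝ) := by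
  have : (Finset.univ.filter
      (fun d : Matrix (Fin ℓ) (Fin n) (ZMod 2) => config d = hv n v)) =
      Finset.univ.image (colMat v) := by
    ext d
    simp [config_eq_hv_iff hv0]
  rw [this, Finset.sum_image fun _ _ _ _ h => colMat_injective hv0 h]
  simp_rw [matPair_colMat, sum_signChar_eq_wt]

lemma ft_AvOp {v : Fin ℓ → ZMod 2} (hv0 : v ≠ 0) (f : Matrix (Fin ℓ) (Fin n) (ZMod 2) → ℝ)
    (Y : Matrix (Fin ℓ) (Fin n) (ZMod 2)) :
    ft (AvOp v f) Y = (n - 2 * (wt (Matrix.vecMul v Y) : ℝ)) * ft f Y := by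
  rw [← sum_signChar_config hv0, ft_eq_signChar, ft_eq_signChar, mul_left_comm]
  congr 1
  simp_rw [AvOp_eq_sum_add, Finset.sum_mul]
  rw [Finset.sum_comm]
  refine Finset.sum_congr rfl fun d _ => ?_
  rw [← Equiv.sum_comp (Equiv.addLeft d) fun X => f X * signChar (matPair X Y), Finset.mul_sum]
  refine Finset.sum_congr rfl fun X _ => ?_
  have hdd : signChar (matPair d Y) * signChar (matPair d Y) = 1 := by
    rw [signChar_eq]; split_ifs <;> norm_num
  simp only [Equiv.coe_addLeft, matPair_add_left, signChar_add]
  linear_combination (-f (d + X) * signChar (matPair X Y)) * hdd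

lemma ft_AvLin_pow {v : Fin ℓ → ZMod 2} (hv0 : v ≠ 0) (m : ℕ)
    (f : Matrix (Fin ℓ) (Fin n) (ZMod 2) → ℝ) (Y : Matrix (Fin ℓ) (Fin n) (ZMod 2)) :
    ft ((AvLin n v ^ m) f) Y = (n - 2 * (wt (Matrix.vecMul v Y) : ℝ)) ^ m * ft f Y := by
  induction m with
  | zero => simp
  | succ m ih =>
    rw [pow_succ', pow_succ', mul_assoc, ← ih]
    exact ft_AvOp hv0 _ Y

end Adjacency

/-- For commuting positive operators `P i` with `a • g ≤ P i g`, the product of the operators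
`P i - c` maps `g` to a function dominating `g`; here the product is described through a linear map
`T` diagonalizing all the `P i`. -/
lemma exists_ge_prod_sub {ι Ω : Type*} (T : Module.End ℝ (Ω → ℝ))
    (P : ι → Module.End ℝ (Ω → ℝ)) (hpos : ∀ i g, 0 ≤ g → 0 ≤ P i g)
    (hcomm : ∀ i j, Commute (P i) (P j)) {c : ℝ} (hc : 0 ≤ c) (φ : ι → Ω → ℝ)
    (S : Finset ι) (hT : ∀ i ∈ S, ∀ g Y, T (P i g - c • g) Y = φ i Y * T g Y) :
    ∀ (g : Ω → ℝ) (a : ℝ), 0 ≤ g → S.card * c + 1 ≤ a → (∀ i ∈ S, a • g ≤ P i g) →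
      ∃ h, g ≤ h ∧ ∀ Y, T h Y = (∏ i ∈ S, φ i Y) * T g Y := by
  classical
  induction S using Finset.induction_on with
  | empty => exact fun g a _ _ _ => ⟨g, le_rfl, fun Y => by simp⟩
  | insert u S hu ih =>
    intro g a hg ha hP
    rw [Finset.card_insert_of_notMem hu] at ha
    push_cast at ha
    have hSc : (0 : ℝ) ≤ S.card * c := by positivity
    have hmono : ∀ i f f', f ≤ f' → P i f ≤ P i f' := fun i f f' hff => by
      have := hpos i (f' - f) (sub_nonneg.2 hff)
      rwa [map_sub, sub_nonneg] at this
    have hu1 := hP u (Finset.mem_insert_self u S)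
    have hg1 : g ≤ P u g - c • g := fun x => by
      have h1 := hu1 x
      have h2 := hg x
      simp only [Pi.smul_apply, smul_eq_mul, Pi.sub_apply, Pi.zero_apply] at h1 h2 ⊢
      nlinarith
    obtain ⟨h, hh, hTh⟩ := ih (fun i hi => hT i (Finset.mem_insert_of_mem hi))
      (P u g - c • g) (a - c) (hg.trans hg1) (by linarith) (fun w hw => by
        have hw1 := hP w (Finset.mem_insert_of_mem hw)
        have h1 := hmono w _ _ hu1
        have h2 := hmono u _ _ hw1
        have h3 : P w (P u g) = P u (P w g) := LinearMap.congr_fun (hcomm w u) g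
        rw [map_smul] at h1 h2
        rw [← h3] at h2
        rw [map_sub, map_smul]
        intro x
        have h1 := h1 x
        have h2 := h2 x
        have h4 := hg x
        have h5 := hpos w g hg x
        simp only [Pi.smul_apply, smul_eq_mul, Pi.sub_apply, Pi.zero_apply] at h1 h2 h4 h5 ⊢
        have ha0 : 0 < a := by linarith
        have hca : c ≤ a := by linarith
        have key : c * (P w g x) * a + (a - c) * (P u g x) * a ≤ a * (P w (P u g) x) := by
          nlinarith [mul_le_mul_of_nonneg_left h1 hc,
            mul_le_mul_of_nonneg_left h2 (sub_nonneg.2 hca)]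
        have key2 : c * (P w g x) + (a - c) * (P u g x) ≤ P w (P u g) x := by
          refine le_of_mul_le_mul_left ?_ ha0
          linarith
        nlinarith [mul_nonneg (mul_nonneg (sub_nonneg.2 hca) hc) h4])
    refine ⟨h, hg1.trans hh, fun Y => ?_⟩
    rw [hTh, hT u (Finset.mem_insert_self u S), Finset.prod_insert hu]
    ring

section Counting

variable {ℓ n : ℕ}

lemma card_filter_pairing_eq_one {u : Fin ℓ → ZMod 2} (hu : u ≠ 0) :
    (Finset.univ.filter fun v : Fin ℓ → ZMod 2 => ∑ j, u j * v j = 1).card = 2 ^ (ℓ - 1) := by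
  obtain ⟨i, hi⟩ := Function.ne_iff.1 hu
  have hi1 : u i = 1 := (zmod_two_eq_zero_or_one _).resolve_left hi
  let e : Fin ℓ → ZMod 2 := Pi.single i 1
  have hshift : ∀ v : Fin ℓ → ZMod 2,
      ∑ j, u j * (v + e) j = (∑ j, u j * v j) + 1 := fun v => by
    simp [e, mul_add, Finset.sum_add_distrib, Pi.single_apply, hi1]
  have hss : ∀ v : Fin ℓ → ZMod 2, v + e + e = v := fun v => by
    funext j
    rw [add_assoc, Pi.add_apply, Pi.add_apply, CharTwo.add_self_eq_zero, add_zero]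
  have hb : ∀ a : ZMod 2, a = 1 ↔ ¬ (a + 1 = 1) := by decide
  have hb' : ∀ a : ZMod 2, ¬ a = 1 ↔ (a + 1 = 1) := by decide
  have heq : (Finset.univ.filter fun v : Fin ℓ → ZMod 2 => ∑ j, u j * v j = 1).card =
      (Finset.univ.filter fun v : Fin ℓ → ZMod 2 => ¬ ∑ j, u j * v j = 1).card := by
    refine Finset.card_nbij' (fun v => v + e) (fun v => v + e) ?_ ?_ ?_ ?_
    · intro v hv
      simpa only [Finset.coe_filter, Finset.mem_univ, true_and, Set.mem_ofPred_eq, hshift, ← hb]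
        using hv
    · intro v hv
      simpa only [Finset.coe_filter, Finset.mem_univ, true_and, Set.mem_ofPred_eq, hshift, ← hb']
        using hv
    · exact fun v _ => hss v
    · exact fun v _ => hss v
  have htot := Finset.card_filter_add_card_filter_not (s := (Finset.univ : Finset (Fin ℓ → ZMod 2)))
    (fun v => ∑ j, u j * v j = 1)
  rw [← heq, Finset.card_univ, Fintype.card_fun, ZMod.card, Fintype.card_fin] at htot
  have hpow : 2 ^ ℓ = 2 ^ (ℓ - 1) * 2 := by rw [← pow_succ, Nat.sub_add_cancel i.pos]
  omega

lemma exists_config_eq {c : (Fin ℓ → ZMod 2) → ℕ} (hc : ∑ u, c u = n) :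
    ∃ X : Matrix (Fin ℓ) (Fin n) (ZMod 2), ∀ u, config X u = c u := by
  have hcard : Fintype.card (Fin n) = Fintype.card (Σ u, Fin (c u)) := by simp [hc]
  let e := Fintype.equivOfCardEq hcard
  refine ⟨fun i k => (e k).1 i, fun u => ?_⟩
  conv_rhs => rw [← Finset.card_fin (c u)]
  refine (Finset.card_bij (fun t _ => e.symm ⟨u, t⟩) ?_ ?_ ?_).symm
  · simp
  · intro a _ b _ h
    simpa using h
  · intro k hk
    have hk' : (e k).1 = u := by
      funext i
      exact (Finset.mem_filter.1 hk).2 i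
    subst hk'
    exact ⟨(e k).2, Finset.mem_univ _, by simp⟩

/-- The number of nonzero elements of a nontrivial subspace over `F_2` is odd. -/
lemma odd_card_filter_ne_zero_mem (V : Submodule (ZMod 2) (Fin ℓ → ZMod 2))
    [DecidablePred (· ∈ V)] (hV : V ≠ ⊥) :
    Odd ((Finset.univ.filter fun u : Fin ℓ → ZMod 2 => u ≠ 0).filter (· ∈ V)).card := by
  have h1 : (Finset.univ.filter (· ∈ V)).card = 2 ^ Module.finrank (ZMod 2) V := by
    have := Module.card_eq_pow_finrank (K := ZMod 2) (V := V)
    rwa [ZMod.card, Fintype.card_subtype] at this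
  have h2 : (Finset.univ.filter fun u : Fin ℓ → ZMod 2 => u ≠ 0).filter (· ∈ V) =
      (Finset.univ.filter (· ∈ V)).erase 0 := by
    ext u
    simp
  rw [h2, Finset.card_erase_of_mem (by simp), h1]
  have h3 : Module.finrank (ZMod 2) V ≠ 0 := fun h => hV (Submodule.finrank_eq_zero.1 h)
  exact Nat.Even.sub_odd Nat.one_le_two_pow ((even_two).pow_of_ne_zero h3) odd_one

end Counting

section Sign

variable {ℓ n : ℕ}

/-- The orthogonal complement of the left kernel of `X`. -/
def leftKerOrth (X : Matrix (Fin ℓ) (Fin n) (ZMod 2)) :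
    Submodule (ZMod 2) (Fin ℓ → ZMod 2) where
  carrier := {u | ∀ v, Matrix.vecMul v X = 0 → ∑ j, u j * v j = 0}
  add_mem' := fun {a b} ha hb v hv => by
    simp [add_mul, Finset.sum_add_distrib, ha v hv, hb v hv]
  zero_mem' := fun v _ => by simp
  smul_mem' := fun c a ha v hv => by
    simp [mul_assoc, ← Finset.mul_sum, ha v hv]

lemma leftKerOrth_ne_bot {X : Matrix (Fin ℓ) (Fin n) (ZMod 2)} (hX : X ≠ 0) :
    leftKerOrth X ≠ ⊥ := by
  intro h
  apply hX
  ext i k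
  have hmem : (fun j => X j k) ∈ leftKerOrth X := fun v hv => by
    have := congrFun hv k
    simpa [Matrix.vecMul, dotProduct, mul_comm] using this
  rw [h, Submodule.mem_bot] at hmem
  exact congrFun hmem i

lemma pow_sub_nonpos_of_valid {ε : ℝ} {m : ℕ} (hmeven : Even m)
    {X : Matrix (Fin ℓ) (Fin n) (ZMod 2)} (hX : X ∈ ValidEps ℓ n ε) {v : Fin ℓ → ZMod 2}
    (hv : Matrix.vecMul v X ≠ 0) :
    ((n : ℝ) - 2 * (wt (Matrix.vecMul v X) : ℝ)) ^ m - (ε * n) ^ m ≤ 0 := by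
  obtain ⟨h1, h2⟩ := hX v hv
  rw [sub_nonpos, ← hmeven.pow_abs]
  exact pow_le_pow_left₀ (abs_nonneg _) (abs_le.2 ⟨by linarith, by linarith⟩) m

lemma phi_nonpos {ε : ℝ} {m : ℕ} (hmeven : Even m)
    {X : Matrix (Fin ℓ) (Fin n) (ZMod 2)} (hX : X ∈ ValidEps ℓ n ε) {u : Fin ℓ → ZMod 2}
    (hu : u ∈ leftKerOrth X) : phi ℓ n ε m u X ≤ 0 := by
  refine Finset.sum_nonpos fun v hv => pow_sub_nonpos_of_valid hmeven hX fun h => ?_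
  have h1 := (Finset.mem_filter.1 hv).2
  rw [hu v h] at h1
  exact zero_ne_one h1

lemma phi_nonneg {ε : ℝ} {m : ℕ} (hmeven : Even m) (hε : 2 ^ (ℓ - 1) * ε ^ m ≤ 1)
    {X : Matrix (Fin ℓ) (Fin n) (ZMod 2)} {u : Fin ℓ → ZMod 2}
    (hu : u ∉ leftKerOrth X) : 0 ≤ phi ℓ n ε m u X := by
  have hu0 : u ≠ 0 := fun h => hu (h ▸ zero_mem _)
  have hex : ∃ v, Matrix.vecMul v X = 0 ∧ ∑ j, u j * v j ≠ 0 := by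
    by_contra hcon
    push Not at hcon
    exact hu hcon
  obtain ⟨v, hv, huv⟩ := hex
  have huv1 : ∑ j, u j * v j = 1 := (zmod_two_eq_zero_or_one _).resolve_left huv
  rw [phi, Finset.sum_sub_distrib, Finset.sum_const, card_filter_pairing_eq_one hu0, sub_nonneg,
    nsmul_eq_mul, mul_pow]
  have h1 := Finset.single_le_sum (s := Finset.univ.filter
      (fun v : Fin ℓ → ZMod 2 => ∑ j, u j * v j = 1))
    (f := fun v => ((n : ℝ) - 2 * (wt (Matrix.vecMul v X) : ℝ)) ^ m)
    (fun v _ => hmeven.pow_nonneg _) (Finset.mem_filter.2 ⟨Finset.mem_univ v, huv1⟩)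
  refine le_trans ?_ h1
  have hwt : wt (Matrix.vecMul v X) = 0 := by rw [hv]; simp [wt]
  simp only [hwt]
  push_cast
  rw [mul_zero, sub_zero, ← mul_assoc]
  exact mul_le_of_le_one_left (by positivity) hε

lemma Phi_nonpos {ε : ℝ} {m : ℕ} (hmeven : Even m) (hε : 2 ^ (ℓ - 1) * ε ^ m ≤ 1)
    {X : Matrix (Fin ℓ) (Fin n) (ZMod 2)} (hX : X ∈ ValidEps ℓ n ε) (hX0 : X ≠ 0) :
    Phi ℓ n ε m X ≤ 0 := by
  classical
  rw [Phi, ← Finset.prod_filter_mul_prod_filter_not _ (· ∈ leftKerOrth X)]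
  refine mul_nonpos_of_nonpos_of_nonneg ?_
    (Finset.prod_nonneg fun u hu => phi_nonneg hmeven hε (Finset.mem_filter.1 hu).2)
  have hodd := odd_card_filter_ne_zero_mem (leftKerOrth X) (leftKerOrth_ne_bot hX0)
  have hneg := Finset.prod_neg (fun u => phi ℓ n ε m u X)
    (s := (Finset.univ.filter fun u : Fin ℓ → ZMod 2 => u ≠ 0).filter (· ∈ leftKerOrth X))
  rw [hodd.neg_one_pow] at hneg
  have hnn : 0 ≤ ∏ u ∈ (Finset.univ.filter fun u : Fin ℓ → ZMod 2 => u ≠ 0).filter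
      (· ∈ leftKerOrth X), -phi ℓ n ε m u X :=
    Finset.prod_nonneg fun u hu =>
      neg_nonneg.2 (phi_nonpos hmeven hX (Finset.mem_filter.1 hu).2)
  linarith

lemma two_pow_mul_pow_le_one (hℓ : 0 < ℓ) {ε : ℝ} (hε0 : 0 < ε) (hε1 : ε < 1) {m : ℕ}
    (hmb : ((ℓ : ℝ) - 1) / Real.logb 2 (1 / ε) ≤ (m : ℝ)) : 2 ^ (ℓ - 1) * ε ^ m ≤ 1 := by
  have hinv : 1 < 1 / ε := (one_lt_div hε0).2 hε1
  have hlog : 0 < Real.logb 2 (1 / ε) := Real.logb_pos one_lt_two hinv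
  rw [div_le_iff₀ hlog, ← Real.logb_pow, Real.le_logb_iff_rpow_le one_lt_two (by positivity)]
    at hmb
  have hcast : ((ℓ : ℝ) - 1) = ((ℓ - 1 : ℕ) : ℝ) := by
    rw [Nat.cast_sub hℓ, Nat.cast_one]
  rw [hcast, Real.rpow_natCast, div_pow, one_pow, le_div_iff₀ (by positivity)] at hmb
  exact hmb

end Sign

/-- The function `Φ_m · ĝ` is the Fourier transform of a function dominating `g`. -/
lemma exists_ge_ft_eq_Phi_mul_ft {ℓ n : ℕ} (hℓ : 0 < ℓ) {ε : ℝ} (hε0 : 0 ≤ ε) (m : ℕ)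
    {g : Matrix (Fin ℓ) (Fin n) (ZMod 2) → ℝ} (hg : 0 ≤ g)
    (hspec : ∀ i : Fin ℓ → ZMod 2, i ≠ 0 → ∃ v : Fin ℓ → ZMod 2,
      (∑ j, i j * v j) = 1 ∧
      ∀ X, ((2 : ℝ) ^ (2 * ℓ - 1) * ε ^ m * (n : ℝ) ^ m + 1) * g X ≤ ((AvOp v)^[m] g) X) :
    ∃ h, g ≤ h ∧ ∀ Y, ft h Y = Phi ℓ n ε m Y * ft g Y := by
  refine exists_ge_prod_sub (ftLin ℓ n)
    (fun u => ∑ v ∈ Finset.univ.filter (fun v : Fin ℓ → ZMod 2 => ∑ j, u j * v j = 1),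
      AvLin n v ^ m) ?_ ?_ (c := 2 ^ (ℓ - 1) * (ε * n) ^ m) (by positivity) (phi ℓ n ε m)
    _ ?_ g ((2 : ℝ) ^ (2 * ℓ - 1) * ε ^ m * (n : ℝ) ^ m + 1) hg ?_ ?_
  · intro u f hf
    rw [LinearMap.sum_apply]
    exact Finset.sum_nonneg fun v _ => AvLin_pow_nonneg v m hf
  · exact fun u w => Commute.sum_left _ _ _ fun v _ => Commute.sum_right _ _ _ fun v' _ =>
      (AvLin_commute v v').pow_pow m m
  · intro u hu f Y
    have hu0 : u ≠ 0 := (Finset.mem_filter.1 hu).2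
    rw [map_sub, map_smul, LinearMap.sum_apply, map_sum, phi, Finset.sum_sub_distrib,
      Finset.sum_const, card_filter_pairing_eq_one hu0, sub_mul, Finset.sum_mul, Pi.sub_apply,
      Finset.sum_apply, nsmul_eq_mul]
    push_cast
    congr 1
    refine Finset.sum_congr rfl fun v hv => ft_AvLin_pow (fun h => ?_) m f Y
    have := (Finset.mem_filter.1 hv).2
    simp [h] at this
  · have hcard : (Finset.univ.filter fun u : Fin ℓ → ZMod 2 => u ≠ 0).card ≤ 2 ^ ℓ := by
      refine (Finset.card_le_univ _).trans ?_
      simp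
    have hcard' : ((Finset.univ.filter fun u : Fin ℓ → ZMod 2 => u ≠ 0).card : ℝ) ≤ 2 ^ ℓ := by
      exact_mod_cast hcard
    have hexp : (2 : ℝ) ^ (2 * ℓ - 1) = 2 ^ ℓ * 2 ^ (ℓ - 1) := by
      rw [← pow_add]
      congr 1
      omega
    rw [hexp, mul_assoc _ (ε ^ m), ← mul_pow, mul_assoc]
    gcongr
  · intro u hu X
    obtain ⟨v, huv, hv⟩ := hspec u (Finset.mem_filter.1 hu).2
    refine (hv X).trans ?_
    rw [LinearMap.sum_apply, Finset.sum_apply]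
    have hpow : ((AvOp v)^[m] g) X = (AvLin n v ^ m) g X := by
      rw [Module.End.pow_apply]
      rfl
    rw [hpow]
    exact Finset.single_le_sum (f := fun w => (AvLin n w ^ m) g X)
      (fun w _ => AvLin_pow_nonneg w m hg X) (Finset.mem_filter.2 ⟨Finset.mem_univ v, huv⟩)

/-- **Feasibility of the spectral dual construction** (feasibility part of Theorem 6.7). -/
theorem spectral_construction_feasible (ℓ n : ℕ) (hℓ : 0 < ℓ) (hn : 0 < n)
    (ε : ℝ) (hε0 : 0 < ε) (hε1 : ε < 1)
    (m : ℕ) (hm0 : 0 < m) (hmeven : Even m)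
    (hmb : ((ℓ : ℝ) - 1) / Real.logb 2 (1 / ε) ≤ (m : ℝ))
    (G : (Fin ℓ → ZMod 2) → ℝ) (hGpos : ∀ u, 0 < G u) (hGsum : ∑ u, G u = 1)
    (hGnat : ∀ u, ∃ c : ℕ, (c : ℝ) = n * G u)
    (Λ : Matrix (Fin ℓ) (Fin n) (ZMod 2) → ℝ)
    (hΛ : ∀ X, Λ X = if ∀ u, (config X u : ℝ) = n * G u then 1 else 0)
    (hspec : ∀ i : Fin ℓ → ZMod 2, i ≠ 0 → ∃ v : Fin ℓ → ZMod 2,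
      (∑ j, i j * v j) = 1 ∧
      ∀ X, ((2 : ℝ) ^ (2 * ℓ - 1) * ε ^ m * (n : ℝ) ^ m + 1) * Λ X ≤ ((AvOp v)^[m] Λ) X)
    (Fbig : Matrix (Fin ℓ) (Fin n) (ZMod 2) → ℝ)
    (hF : ∀ X, Fbig X = Phi ℓ n ε m X * (ft Λ X) ^ 2)
    (f : Matrix (Fin ℓ) (Fin n) (ZMod 2) → ℝ)
    (hf : ∀ X, f X = Fbig X / ft Fbig 0) :
    0 < ft Fbig 0 ∧ ft f 0 = 1 ∧ (∀ X, 0 ≤ ft f X) ∧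
      ∀ X ∈ ValidEps ℓ n ε, X ≠ 0 → f X ≤ 0 := by
  have hΛ0 : 0 ≤ Λ := fun X => by
    rw [hΛ]
    split_ifs <;> simp
  choose c hc using hGnat
  have hcsum : ∑ u, c u = n := by
    have : ((∑ u, c u : ℕ) : ℝ) = n := by
      push_cast
      simp_rw [hc, ← Finset.mul_sum, hGsum, mul_one]
    exact_mod_cast this
  obtain ⟨X₀, hX₀⟩ := exists_config_eq hcsum
  have hΛX₀ : 0 < Λ X₀ := by
    rw [hΛ, if_pos fun u => by rw [hX₀, hc]]
    exact one_pos
  obtain ⟨h, hge, hft⟩ := exists_ge_ft_eq_Phi_mul_ft hℓ hε0.le m hΛ0 hspec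
  have hFbig : Fbig = fun Y => ft h Y * ft Λ Y := by
    funext Y
    rw [hF, hft]
    ring
  have hpos : 0 < ft Fbig 0 := by
    rw [hFbig]
    exact ft_mul_ft_zero_pos (hΛ0.trans hge) hΛ0 (hΛX₀.trans_le (hge X₀)) hΛX₀
  have hff : ∀ X, ft f X = ft Fbig X / ft Fbig 0 := fun X => by
    have : f = (ft Fbig 0)⁻¹ • Fbig := by
      funext Y
      rw [hf, Pi.smul_apply, smul_eq_mul, div_eq_inv_mul]
    rw [this, div_eq_inv_mul]
    exact congrFun (map_smul (ftLin ℓ n) (ft Fbig 0)⁻¹ Fbig) X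
  refine ⟨hpos, ?_, fun X => ?_, fun X hX hX0 => ?_⟩
  · rw [hff, div_self hpos.ne']
  · rw [hff, hFbig]
    rw [hFbig] at hpos
    exact div_nonneg (ft_mul_ft_nonneg (hΛ0.trans hge) hΛ0 X) hpos.le
  · rw [hf, hF]
    exact div_nonpos_of_nonpos_of_nonneg (mul_nonpos_of_nonpos_of_nonneg
      (Phi_nonpos hmeven (two_pow_mul_pow_le_one hℓ hε0 hε1 hmb) hX hX0) (sq_nonneg _)) hpos.le
end
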